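/- For every integer k ≥ 1 and every dimension d ≥ 4, α_{k,d} ≤ π²k²/(d − 3 + (k+1)π)². -/

import Mathlib

open MeasureTheory Real Filter

noncomputable section

/-- Euclidean space `ℝ^d`. -/
abbrev Euc (d : ℕ) := EuclideanSpace ℝ (Fin d)

/-- The Rayleigh quotient of a function `u` on a set `Ω ⊆ ℝ^d`. -/
noncomputable def rayleigh {d : ℕ} (Ω : Set (Euc d)) (u : Euc d → ℝ) : ℝ :=
  (∫ x in Ω, ‖fderiv ℝ u x‖ ^ 2) / (∫ x in Ω, (u x) ^ 2)

/-- The `k`-th Neumann eigenvalue of `Ω ⊆ ℝ^d`, defined by the variational (min-max)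
principle: the infimum, over all subspaces `V` of smooth functions `ℝ^d → ℝ` whose space of
restrictions to `Ω` is `(k+1)`-dimensional, of the supremum of the Rayleigh quotient over
the elements of `V` that are nonzero in `L²(Ω)`. -/
noncomputable def neumannEigenvalue {d : ℕ} (k : ℕ) (Ω : Set (Euc d)) : ℝ :=
  sInf { t : ℝ | ∃ V : Submodule ℝ (Euc d → ℝ),
    (∀ u ∈ V, ContDiff ℝ (⊤ : ℕ∞) u) ∧
    Module.finrank ℝ (V.map (LinearMap.funLeft ℝ ℝ ((↑) : Ω → Euc d))) = k + 1 ∧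
    t = sSup { r : ℝ | ∃ u ∈ V, (0 < ∫ x in Ω, (u x) ^ 2) ∧ r = rayleigh Ω u } }

/-- A nonempty bounded convex open subset of `ℝ^d`. -/
def IsConvexDomain {d : ℕ} (Ω : Set (Euc d)) : Prop :=
  Ω.Nonempty ∧ IsOpen Ω ∧ Bornology.IsBounded Ω ∧ Convex ℝ Ω

/-- The optimal constant `α_{k,d}`: the infimum of `μ_k(Ω₁)/μ_k(Ω₂)` over all pairs of
nonempty bounded convex open sets `Ω₁ ⊆ Ω₂ ⊂ ℝ^d`. -/
noncomputable def alphaConst (k d : ℕ) : ℝ :=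
  sInf { r : ℝ | ∃ Ω₁ Ω₂ : Set (Euc d), IsConvexDomain Ω₁ ∧ IsConvexDomain Ω₂ ∧ Ω₁ ⊆ Ω₂ ∧
    r = neumannEigenvalue k Ω₁ / neumannEigenvalue k Ω₂ }

/-- The Bessel function of the first kind of order `ν` (for `x > 0`). -/
noncomputable def besselJ (ν : ℝ) (x : ℝ) : ℝ :=
  ∑' m : ℕ, ((-1 : ℝ) ^ m / (m.factorial * Real.Gamma (m + ν + 1))) * (x / 2) ^ (2 * (m : ℝ) + ν)

/-- The first positive zero `j_{ν,1}` of the Bessel function `J_ν`. -/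
noncomputable def besselZero1 (ν : ℝ) : ℝ :=
  sInf {x : ℝ | 0 < x ∧ besselJ ν x = 0}

/-- The second positive zero `j_{ν,2}` of the Bessel function `J_ν`. -/
noncomputable def besselZero2 (ν : ℝ) : ℝ :=
  sInf {x : ℝ | besselZero1 ν < x ∧ besselJ ν x = 0}

/-- The closed unit cube. -/
def cube (n : ℕ) : Set (Fin n → ℝ) := Set.Icc 0 1

/-- Uniform measure on the unit cube. -/
def muQ (n : ℕ) : Measure (Fin n → ℝ) := volume.restrict (cube n)

lemma isCompact_cube (n : ℕ) : IsCompact (cube n) := isCompact_Icc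

lemma measurableSet_cube (n : ℕ) : MeasurableSet (cube n) := (isCompact_cube n).measurableSet

instance muQ_prob (n : ℕ) : IsProbabilityMeasure (muQ n) := by
  constructor
  simp [muQ, cube, Real.volume_Icc_pi]

lemma integrable_muQ {n : ℕ} {f : (Fin n → ℝ) → ℝ} (hf : Continuous f) :
    Integrable f (muQ n) :=
  hf.continuousOn.integrableOn_compact (isCompact_cube n)

lemma variance_id {α : Type*} [MeasurableSpace α] (μ : Measure α) [IsProbabilityMeasure μ]
    (f : α → ℝ) (h1 : Integrable f μ) (h2 : Integrable (fun x => f x ^ 2) μ) :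
    ∫ x, (f x - ∫ y, f y ∂μ) ^ 2 ∂μ = ∫ x, f x ^ 2 ∂μ - (∫ x, f x ∂μ) ^ 2 := by
  set m := ∫ y, f y ∂μ with hm
  have : ∀ x, (f x - m) ^ 2 = f x ^ 2 - 2 * m * f x + m ^ 2 := fun x => by ring
  simp_rw [this]
  have h3 : Integrable (fun x => f x ^ 2 - 2 * m * f x) μ := h2.sub (h1.const_mul _)
  rw [integral_add h3 (integrable_const _),
    integral_sub h2 (h1.const_mul _), integral_const_mul, ← hm]
  simp
  ring

lemma jensen_sq {α : Type*} [MeasurableSpace α] (μ : Measure α) [IsProbabilityMeasure μ]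
    (f : α → ℝ) (h1 : Integrable f μ) (h2 : Integrable (fun x => f x ^ 2) μ) :
    (∫ x, f x ∂μ) ^ 2 ≤ ∫ x, f x ^ 2 ∂μ := by
  have := variance_id μ f h1 h2
  have h : 0 ≤ ∫ x, (f x - ∫ y, f y ∂μ) ^ 2 ∂μ := integral_nonneg fun x => sq_nonneg _
  linarith

lemma segment_sq {n : ℕ} (f : (Fin n → ℝ) → ℝ) (hf : ContDiff ℝ 1 f) (z z' : Fin n → ℝ)
    (hz : z ∈ cube n) (hz' : z' ∈ cube n) :
    (f z - f z') ^ 2 ≤ ∫ t in (0:ℝ)..1, ‖fderiv ℝ f (z' + t • (z - z'))‖ ^ 2 := by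
  have hnorm : ‖z - z'‖ ≤ 1 := by
    rw [pi_norm_le_iff_of_nonneg zero_le_one]
    intro i
    have a1 := hz.1 i; have a2 := hz.2 i; have a3 := hz'.1 i; have a4 := hz'.2 i
    simp at a1 a2 a3 a4
    rw [Real.norm_eq_abs, abs_le]; simp; constructor <;> linarith
  have hfd : Continuous (fderiv ℝ f) := hf.continuous_fderiv (by norm_num)
  have hder : ∀ t : ℝ, HasDerivAt (fun t : ℝ => f (z' + t • (z - z')))
      (fderiv ℝ f (z' + t • (z - z')) (z - z')) t := by
    intro t
    have h1 : HasDerivAt (fun t : ℝ => z' + t • (z - z')) (z - z') t := by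
      simpa using ((hasDerivAt_id t).smul_const (z - z')).const_add z'
    exact ((hf.differentiable (by norm_num) _).hasFDerivAt).comp_hasDerivAt t h1
  have hcont : Continuous fun t : ℝ => fderiv ℝ f (z' + t • (z - z')) (z - z') := by
    fun_prop
  have hftc := intervalIntegral.integral_eq_sub_of_hasDerivAt (a := 0) (b := 1)
    (fun t _ => hder t) (hcont.intervalIntegrable _ _)
  simp only [one_smul, zero_smul, add_zero, add_sub_cancel] at hftc
  rw [← hftc]
  have hp : IsProbabilityMeasure (volume.restrict (Set.Ioc (0:ℝ) 1)) := ⟨by simp⟩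
  rw [intervalIntegral.integral_of_le zero_le_one, intervalIntegral.integral_of_le zero_le_one]
  refine (jensen_sq _ _ (hcont.integrableOn_Ioc) ((hcont.pow 2).integrableOn_Ioc)).trans ?_
  refine integral_mono ((hcont.pow 2).integrableOn_Ioc)
    ((Continuous.integrableOn_Ioc (by fun_prop))) ?_
  intro t
  have := (fderiv ℝ f (z' + t • (z - z'))).le_opNorm (z - z')
  have h2 : ‖fderiv ℝ f (z' + t • (z - z')) (z - z')‖ ≤ ‖fderiv ℝ f (z' + t • (z - z'))‖ :=
    this.trans (mul_le_of_le_one_right (norm_nonneg _) hnorm)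
  calc _ = ‖fderiv ℝ f (z' + t • (z - z')) (z - z')‖ ^ 2 := by simp
    _ ≤ ‖fderiv ℝ f (z' + t • (z - z'))‖ ^ 2 := by gcongr

lemma contract_int {n : ℕ} (G : (Fin n → ℝ) → ℝ) (hG : Continuous G) (h0 : ∀ z, 0 ≤ G z)
    (z' : Fin n → ℝ) (hz' : z' ∈ cube n) (t : ℝ) (ht : 1 / 2 ≤ t) (ht1 : t ≤ 1) :
    ∫ z, G (z' + t • (z - z')) ∂(muQ n) ≤ 2 ^ n * ∫ z, G z ∂(muQ n) := by
  have tpos : 0 < t := by linarith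
  have hI : Integrable ((cube n).indicator G) :=
    (hG.continuousOn.integrableOn_compact (isCompact_cube n)).integrable_indicator
      (measurableSet_cube n)
  set c := z' - t • z' with hc
  have hI2 : Integrable fun z => (cube n).indicator G (c + t • z) :=
    (hI.comp_add_left c).comp_smul tpos.ne'
  have e1 : ∀ z, z' + t • (z - z') = c + t • z := fun z => by
    rw [hc, smul_sub]; abel
  simp_rw [e1]
  have step : ∫ z, G (c + t • z) ∂(muQ n) ≤ ∫ z, (cube n).indicator G (c + t • z) := by
    unfold muQ
    rw [← integral_indicator (measurableSet_cube n)]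
    refine integral_mono ?_ hI2 ?_
    · exact (((show Continuous fun z => G (c + t • z) by fun_prop)).continuousOn.integrableOn_compact
        (isCompact_cube n)).integrable_indicator (measurableSet_cube n)
    · intro z
      by_cases hz : z ∈ cube n
      · have : c + t • z ∈ cube n := by
          rw [← e1]
          exact (convex_Icc _ _).add_smul_sub_mem hz' hz ⟨tpos.le, ht1⟩
        simp [hz, this]
      · rw [Set.indicator_of_notMem hz]
        exact Set.indicator_nonneg (fun x _ => h0 x) _
  refine step.trans ?_
  have e2 := Measure.integral_comp_smul (volume : Measure (Fin n → ℝ))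
    (fun y => (cube n).indicator G (c + y)) t
  rw [e2, integral_add_left_eq_self, integral_indicator (measurableSet_cube n)]
  simp only [Module.finrank_fintype_fun_eq_card, Fintype.card_fin, smul_eq_mul]
  change |(t ^ n)⁻¹| * ∫ z, G z ∂(muQ n) ≤ _
  refine mul_le_mul_of_nonneg_right ?_ (integral_nonneg h0)
  rw [abs_of_pos (by positivity), ← inv_pow]
  gcongr
  rw [inv_le_comm₀ tpos (by norm_num)]
  linarith

/-- Fubini for continuous functions on compact sets. -/
lemma swap_cube {X Y : Type*} [TopologicalSpace X] [TopologicalSpace Y] [MeasurableSpace X]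
    [MeasurableSpace Y] [BorelSpace X] [BorelSpace Y] [T2Space X] [T2Space Y]
    [SecondCountableTopology X] [SecondCountableTopology Y]
    (μ : Measure X) (ν : Measure Y) [IsLocallyFiniteMeasure μ] [IsLocallyFiniteMeasure ν]
    [SigmaFinite μ] [SigmaFinite ν]
    (K : Set X) (L : Set Y) (hK : IsCompact K) (hL : IsCompact L) (F : X → Y → ℝ)
    (hF : Continuous (Function.uncurry F)) :
    ∫ x in K, ∫ y in L, F x y ∂ν ∂μ = ∫ y in L, ∫ x in K, F x y ∂μ ∂ν := by
  apply integral_integral_swap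
  rw [Measure.prod_restrict]
  exact hF.continuousOn.integrableOn_compact (hK.prod hL)

lemma cont_param {X : Type*} [TopologicalSpace X] [FirstCountableTopology X]
    [LocallyCompactSpace X] {n : ℕ} (F : X → (Fin n → ℝ) → ℝ)
    (hF : Continuous (Function.uncurry F)) : Continuous fun x => ∫ z, F x z ∂(muQ n) :=
  continuous_parametric_integral_of_continuous hF (isCompact_cube n)

lemma poincare {n : ℕ} (f : (Fin n → ℝ) → ℝ) (hf : ContDiff ℝ 1 f) :
    ∫ z, (f z - ∫ y, f y ∂(muQ n)) ^ 2 ∂(muQ n) ≤ 2 ^ n * ∫ z, ‖fderiv ℝ f z‖ ^ 2 ∂(muQ n) := by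
  have hfc := hf.continuous
  have hfd : Continuous (fderiv ℝ f) := hf.continuous_fderiv (by norm_num)
  set G : (Fin n → ℝ) → ℝ := fun z => ‖fderiv ℝ f z‖ ^ 2 with hG
  have hGc : Continuous G := by fun_prop
  have hG0 : ∀ z, 0 ≤ G z := fun z => by positivity
  have ae_cube : ∀ {P : (Fin n → ℝ) → Prop}, (∀ z ∈ cube n, P z) → ∀ᵐ z ∂(muQ n), P z :=
    fun h => (ae_restrict_iff' (measurableSet_cube n)).2 (Eventually.of_forall h)
  -- step C
  have sC : ∀ z, (f z - ∫ y, f y ∂(muQ n)) ^ 2 ≤ ∫ y, (f z - f y) ^ 2 ∂(muQ n) := by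
    intro z
    have e : f z - ∫ y, f y ∂(muQ n) = ∫ y, (f z - f y) ∂(muQ n) := by
      rw [integral_sub (integrable_const _) (integrable_muQ hfc)]; simp
    rw [e]
    exact jensen_sq _ _ (integrable_muQ (by fun_prop)) (integrable_muQ (by fun_prop))
  let Gs : (Fin n → ℝ) → (Fin n → ℝ) → ℝ → ℝ := fun z y t => G (y + t • (z - y))
  have hGs : Continuous fun p : (Fin n → ℝ) × (Fin n → ℝ) × ℝ => Gs p.1 p.2.1 p.2.2 := by
    fun_prop
  let S : (Fin n → ℝ) → (Fin n → ℝ) → ℝ := fun z y => ∫ t in Set.Icc (0:ℝ) 1, Gs z y t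
  have hS : Continuous fun p : (Fin n → ℝ) × (Fin n → ℝ) => S p.1 p.2 := by
    refine continuous_parametric_integral_of_continuous (f := fun (p : (Fin n → ℝ) × (Fin n → ℝ)) t => Gs p.1 p.2 t) ?_ isCompact_Icc
    simp only [Function.uncurry_def]; fun_prop
  have s1 : ∫ z, (f z - ∫ y, f y ∂(muQ n)) ^ 2 ∂(muQ n) ≤ ∫ z, ∫ y, S z y ∂(muQ n) ∂(muQ n) := by
    refine integral_mono_ae (integrable_muQ (by fun_prop)) (integrable_muQ (cont_param _ hS)) ?_
    refine ae_cube fun z hz => ?_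
    refine (sC z).trans ?_
    refine integral_mono_ae (integrable_muQ (by fun_prop)) (integrable_muQ (by fun_prop)) ?_
    refine ae_cube fun y hy => ?_
    refine (segment_sq f hf z y hz hy).trans ?_
    rw [intervalIntegral.integral_of_le zero_le_one, ← integral_Icc_eq_integral_Ioc]
  refine s1.trans ?_
  let A : ℝ → ℝ := fun t => ∫ z, ∫ y, Gs z y t ∂(muQ n) ∂(muQ n)
  have hA : ∫ z, ∫ y, S z y ∂(muQ n) ∂(muQ n) = ∫ t in Set.Icc (0:ℝ) 1, A t := by
    have : ∀ z, ∫ y, S z y ∂(muQ n) = ∫ t in Set.Icc (0:ℝ) 1, ∫ y, Gs z y t ∂(muQ n) := fun z =>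
      swap_cube volume volume _ _ (isCompact_cube n) isCompact_Icc _ (by
        simp only [Function.uncurry_def]; fun_prop)
    simp_rw [this]
    refine swap_cube volume volume _ _ (isCompact_cube n) isCompact_Icc (fun z t => ∫ y, Gs z y t ∂(muQ n)) ?_
    refine cont_param (fun (p : (Fin n → ℝ) × ℝ) y => Gs p.1 y p.2) ?_
    simp only [Function.uncurry_def]; fun_prop
  rw [hA]
  have hAb : ∀ t ∈ Set.Icc (0:ℝ) 1, A t ≤ 2 ^ n * ∫ z, G z ∂(muQ n) := by
    intro t ht
    have key : ∀ B : (Fin n → ℝ) → ℝ, Continuous B → (∀ y ∈ cube n, B y ≤ 2 ^ n * ∫ z, G z ∂(muQ n)) →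
        ∫ y, B y ∂(muQ n) ≤ 2 ^ n * ∫ z, G z ∂(muQ n) := by
      intro B hB hle
      have := integral_mono_ae (integrable_muQ hB) (integrable_const (2 ^ n * ∫ z, G z ∂(muQ n))) (ae_cube hle)
      simpa using this
    by_cases h : 1 / 2 ≤ t
    · have e : A t = ∫ y, ∫ z, Gs z y t ∂(muQ n) ∂(muQ n) :=
        swap_cube volume volume _ _ (isCompact_cube n) (isCompact_cube n) (fun z y => Gs z y t)
          (by simp only [Function.uncurry_def]; fun_prop)
      rw [e]
      refine key _ (cont_param (fun y z => Gs z y t) (by simp only [Function.uncurry_def]; fun_prop)) ?_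
      intro y hy
      exact contract_int G hGc hG0 y hy t h ht.2
    · refine key _ (cont_param (fun z y => Gs z y t) (by simp only [Function.uncurry_def]; fun_prop)) ?_
      intro z hz
      have e : ∀ y, Gs z y t = G (z + (1 - t) • (y - z)) := by
        intro y
        simp only [Gs]
        congr 1
        ext i; simp; ring
      simp_rw [e]
      push Not at h
      exact contract_int G hGc hG0 z hz (1 - t) (by linarith) (by linarith [ht.1])
  have hAc : Continuous A := by
    refine cont_param (fun t z => ∫ y, Gs z y t ∂(muQ n)) ?_
    refine cont_param (fun (p : ℝ × (Fin n → ℝ)) y => Gs p.2 y p.1) ?_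
    simp only [Function.uncurry_def]; fun_prop
  have := setIntegral_mono_on (hAc.integrableOn_Icc) (integrable_const _) measurableSet_Icc hAb
    (μ := volume)
  simpa using this

/-- Coordinates `(x, z) ↦ (x, z₁, …, z_n)`. -/
def JL (n : ℕ) : ℝ × (Fin n → ℝ) →L[ℝ] Euc (n + 1) :=
  LinearMap.toContinuousLinearMap
    { toFun := fun p => WithLp.toLp 2 (Fin.cons p.1 p.2)
      map_add' := by
        intro p q
        ext i
        refine Fin.cases ?_ (fun j => ?_) i <;> simp
      map_smul' := by
        intro c p
        ext i
        refine Fin.cases ?_ (fun j => ?_) i <;> simp }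

lemma JL_zero {n : ℕ} (p : ℝ × (Fin n → ℝ)) : JL n p 0 = p.1 := by simp [JL]
lemma JL_succ {n : ℕ} (p : ℝ × (Fin n → ℝ)) (i : Fin n) : JL n p i.succ = p.2 i := by simp [JL]

lemma JL_norm_sq {n : ℕ} (p : ℝ × (Fin n → ℝ)) : ‖JL n p‖ ^ 2 = p.1 ^ 2 + ∑ i, p.2 i ^ 2 := by
  rw [EuclideanSpace.norm_sq_eq, Fin.sum_univ_succ]
  simp [JL_zero, JL_succ]

/-- The domain `{a < x < b, 0 < y_i < h x}`. -/
def Dom {n : ℕ} (a b : ℝ) (h : ℝ → ℝ) : Set (Euc (n + 1)) :=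
  {p | (a < p 0 ∧ p 0 < b) ∧ ∀ i : Fin n, 0 < p i.succ ∧ p i.succ < h (p 0)}

lemma Dom_open {n : ℕ} (a b : ℝ) (h : ℝ → ℝ) (hh : Continuous h) :
    IsOpen (Dom (n := n) a b h) := by
  have e : Dom (n := n) a b h = ({p | a < p 0} ∩ {p | p 0 < b}) ∩
      ⋂ i : Fin n, ({p | 0 < p i.succ} ∩ {p | p i.succ < h (p 0)}) := by
    ext p; simp [Dom]
  rw [e]
  refine ((isOpen_lt (by fun_prop) (by fun_prop)).inter (isOpen_lt (by fun_prop) (by fun_prop))).inter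
    (isOpen_iInter_of_finite fun i => 
      (isOpen_lt (by fun_prop) (by fun_prop)).inter (isOpen_lt (by fun_prop) (by fun_prop)))

lemma Dom_bounded {n : ℕ} (a b : ℝ) (h : ℝ → ℝ) (hh : Continuous h) :
    Bornology.IsBounded (Dom (n := n) a b h) := by
  obtain ⟨M, hM⟩ := (isCompact_Icc (a := a) (b := b)).exists_bound_of_continuousOn hh.continuousOn
  have hK : IsCompact (JL n '' ((Set.Icc a b) ×ˢ (Set.Icc 0 (fun _ => M)))) :=
    (isCompact_Icc.prod isCompact_Icc).image (JL n).continuous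
  refine hK.isBounded.subset ?_
  intro p hp
  refine ⟨(p 0, fun i => p i.succ), ⟨⟨hp.1.1.le, hp.1.2.le⟩, ⟨fun i => (hp.2 i).1.le, fun i => ?_⟩⟩, ?_⟩
  · have := hM (p 0) ⟨hp.1.1.le, hp.1.2.le⟩
    have h2 := (hp.2 i).2
    rw [Real.norm_eq_abs] at this
    show p i.succ ≤ M
    linarith [le_abs_self (h (p 0))]
  · ext i
    refine Fin.cases ?_ (fun j => ?_) i
    · rw [JL_zero]
    · rw [JL_succ]

lemma Dom_convex {n : ℕ} (a b : ℝ) (h : ℝ → ℝ) (hh : ConcaveOn ℝ Set.univ h) :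
    Convex ℝ (Dom (n := n) a b h) := by
  intro p hp q hq s t hs ht hst
  have hc := hh.2 (Set.mem_univ (p 0)) (Set.mem_univ (q 0)) hs ht hst
  simp only [smul_eq_mul] at hc
  have comb : ∀ {x y x' y' : ℝ}, x < y → x' < y' → s * x + t * x' < s * y + t * y' := by
    intro x y x' y' h1 h2
    rcases hs.eq_or_lt with h0 | h0
    · have : t = 1 := by linarith
      subst h0; subst this; linarith
    · have := mul_lt_mul_of_pos_left h1 h0
      have := mul_le_mul_of_nonneg_left h2.le ht
      linarith
  refine ⟨⟨?_, ?_⟩, fun i => ⟨?_, ?_⟩⟩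
  · have := comb hp.1.1 hq.1.1
    simp only [PiLp.add_apply, PiLp.smul_apply, smul_eq_mul]
    calc a = s * a + t * a := by rw [← add_mul, hst, one_mul]
      _ < _ := this
  · have := comb hp.1.2 hq.1.2
    simp only [PiLp.add_apply, PiLp.smul_apply, smul_eq_mul]
    calc _ < _ := this
      _ = b := by rw [← add_mul, hst, one_mul]
  · have := comb (hp.2 i).1 (hq.2 i).1
    simp only [PiLp.add_apply, PiLp.smul_apply, smul_eq_mul]
    simpa using this
  · have := comb (hp.2 i).2 (hq.2 i).2
    simp only [PiLp.add_apply, PiLp.smul_apply, smul_eq_mul]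
    exact this.trans_le hc

lemma Dom_nonempty {n : ℕ} (a b : ℝ) (h : ℝ → ℝ) (hab : a < b)
    (hh : ∀ x, a < x → x < b → 0 < h x) : (Dom (n := n) a b h).Nonempty := by
  have h1 : a < (a + b) / 2 := by linarith
  have h2 : (a + b) / 2 < b := by linarith
  have := hh _ h1 h2
  refine ⟨JL n ((a + b) / 2, fun _ => h ((a + b) / 2) / 2), ?_, fun i => ?_⟩
  · rw [JL_zero]; exact ⟨h1, h2⟩
  · rw [JL_zero, JL_succ]; constructor <;> simp only <;> linarith

lemma Dom_isConvexDomain {n : ℕ} (a b : ℝ) (h : ℝ → ℝ) (hab : a < b)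
    (hh : ∀ x, a < x → x < b → 0 < h x) (hc : Continuous h) (hcc : ConcaveOn ℝ Set.univ h) :
    IsConvexDomain (Dom (n := n) a b h) :=
  ⟨Dom_nonempty a b h hab hh, Dom_open a b h hc, Dom_bounded a b h hc, Dom_convex a b h hcc⟩

lemma integrableOn_bounded {n : ℕ} {s : Set (Euc n)} (hs : Bornology.IsBounded s)
    {f : Euc n → ℝ} (hf : Continuous f) : IntegrableOn f s :=
  (hf.continuousOn.integrableOn_compact hs.isCompact_closure).mono_set subset_closure

lemma JL_eq (n : ℕ) : ⇑(JL n) = WithLp.toLp 2 ∘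
    ⇑(MeasurableEquiv.piFinSuccAbove (fun _ : Fin (n + 1) => ℝ) 0).symm := by
  funext p
  ext i
  refine Fin.cases ?_ (fun j => ?_) i
  · rw [JL_zero]; rfl
  · rw [JL_succ]; rfl

lemma JL_measurePreserving (n : ℕ) : MeasurePreserving (JL n) (volume.prod volume) volume := by
  have h1 := (volume_preserving_piFinSuccAbove (fun _ : Fin (n + 1) => ℝ) 0).symm
  have h2 := (PiLp.volume_preserving_toLp (Fin (n + 1))).comp h1
  rw [JL_eq]
  exact h2

lemma JL_measurableEmbedding (n : ℕ) : MeasurableEmbedding (JL n) := by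
  have h1 := ((MeasurableEquiv.piFinSuccAbove (fun _ : Fin (n + 1) => ℝ) 0).symm).measurableEmbedding
  have h2 := (MeasurableEquiv.toLp 2 (Fin (n + 1) → ℝ)).measurableEmbedding.comp h1
  rw [JL_eq]
  exact h2

open scoped Pointwise in
lemma slice_int {n : ℕ} (F : (Fin n → ℝ) → ℝ) (r : ℝ) (hr : 0 < r) :
    ∫ y in Set.pi Set.univ (fun _ => Set.Ioo 0 r), F y = r ^ n * ∫ z, F (r • z) ∂(muQ n) := by
  have h1 : ∫ z, F (r • z) ∂(muQ n) =
      ∫ z in Set.pi Set.univ (fun _ : Fin n => Set.Ioo (0:ℝ) 1), F (r • z) :=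
    setIntegral_congr_set (Measure.univ_pi_Ioo_ae_eq_Icc).symm
  have h2 : r • (Set.pi Set.univ (fun _ : Fin n => Set.Ioo (0:ℝ) 1)) =
      Set.pi Set.univ (fun _ => Set.Ioo 0 r) := by
    ext y
    rw [Set.mem_smul_set_iff_inv_smul_mem₀ hr.ne']
    simp only [Set.mem_pi, Set.mem_univ, true_implies, Pi.smul_apply, smul_eq_mul, Set.mem_Ioo]
    refine forall_congr' fun i => ?_
    rw [inv_mul_lt_iff₀ hr, mul_one, mul_pos_iff_of_pos_left (inv_pos.2 hr)]
  rw [h1, Measure.setIntegral_comp_smul_of_pos _ _ _ hr, h2]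
  simp only [Module.finrank_fintype_fun_eq_card, Fintype.card_fin, smul_eq_mul]
  field_simp

lemma fubini {n : ℕ} (a b : ℝ) (h : ℝ → ℝ) (hab : a ≤ b) (hh : ∀ x, a < x → x < b → 0 < h x)
    (hc : Continuous h) (f : Euc (n + 1) → ℝ) (hf : Continuous f) :
    ∫ p in Dom a b h, f p =
      ∫ x in a..b, (h x) ^ n * ∫ z, f (JL n (x, h x • z)) ∂(muQ n) := by
  have hmeas : MeasurableSet (Dom (n := n) a b h) := (Dom_open a b h hc).measurableSet
  have hintg : Integrable ((Dom a b h).indicator f) volume :=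
    (integrableOn_bounded (Dom_bounded a b h hc) hf).integrable_indicator hmeas
  rw [← integral_indicator hmeas,
    ← (JL_measurePreserving n).integral_comp (JL_measurableEmbedding n)]
  have hintg2 : Integrable (fun p => (Dom a b h).indicator f (JL n p)) (volume.prod volume) :=
    ((JL_measurePreserving n).integrable_comp_emb (JL_measurableEmbedding n)).2 hintg
  rw [integral_prod _ hintg2]
  rw [intervalIntegral.integral_of_le hab, integral_Ioc_eq_integral_Ioo,
    ← integral_indicator measurableSet_Ioo]
  congr 1
  ext x
  by_cases hx : x ∈ Set.Ioo a b
  · rw [Set.indicator_of_mem hx, ← slice_int (fun y => f (JL n (x, y))) _ (hh x hx.1 hx.2),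
      ← integral_indicator (MeasurableSet.univ_pi fun _ => measurableSet_Ioo)]
    congr 1
    ext y
    by_cases hy : y ∈ Set.pi Set.univ (fun _ : Fin n => Set.Ioo 0 (h x))
    · rw [Set.indicator_of_mem hy, Set.indicator_of_mem]
      refine ⟨by rw [JL_zero]; exact hx, fun i => ?_⟩
      rw [JL_zero, JL_succ]
      exact hy i (Set.mem_univ _)
    · rw [Set.indicator_of_notMem hy, Set.indicator_of_notMem]
      intro hmem
      refine hy fun i _ => ?_
      have := hmem.2 i
      rwa [JL_zero, JL_succ] at this
  · rw [Set.indicator_of_notMem hx]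
    have : ∀ y, (Dom a b h).indicator f (JL n (x, y)) = 0 := by
      intro y
      apply Set.indicator_of_notMem
      intro hmem
      have := hmem.1
      rw [JL_zero] at this
      exact hx this
    simp [this]

lemma riccati (a b Λ : ℝ) (hab : a ≤ b) (w w' q q' g g' : ℝ → ℝ)
    (hw : ∀ x, HasDerivAt w (w' x) x) (hw'c : Continuous w')
    (hq : ∀ x ∈ Set.Icc a b, HasDerivAt q (q' x) x) (hq'c : ContinuousOn q' (Set.Icc a b))
    (hg : ∀ x, HasDerivAt g (g' x) x) (hg'c : Continuous g')
    (hw0 : ∀ x ∈ Set.Icc a b, 0 ≤ w x)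
    (hR : ∀ x ∈ Set.Icc a b, w' x * q x + w x * q' x + w x * q x ^ 2 ≤ -(Λ * w x))
    (ha : w a = 0 ∨ g a = 0) (hb : w b = 0 ∨ g b = 0) :
    Λ * ∫ x in a..b, w x * g x ^ 2 ≤ ∫ x in a..b, w x * g' x ^ 2 := by
  have hwc : Continuous w := continuous_iff_continuousAt.2 fun x => (hw x).continuousAt
  have hgc : Continuous g := continuous_iff_continuousAt.2 fun x => (hg x).continuousAt
  have hqc : ContinuousOn q (Set.Icc a b) := fun x hx => (hq x hx).continuousAt.continuousWithinAt
  set F' : ℝ → ℝ := fun x => (w' x * q x + w x * q' x) * g x ^ 2 + w x * q x * (2 * g x * g' x) with hF'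
  have hF'c : ContinuousOn F' (Set.Icc a b) := by
    have := hwc.continuousOn (s := Set.Icc a b)
    have := hgc.continuousOn (s := Set.Icc a b)
    have := hw'c.continuousOn (s := Set.Icc a b)
    have := hg'c.continuousOn (s := Set.Icc a b)
    fun_prop
  have hF : ∀ x ∈ Set.uIcc a b, HasDerivAt (fun x => w x * q x * g x ^ 2) (F' x) x := by
    intro x hx
    rw [Set.uIcc_of_le hab] at hx
    have h1 := ((hw x).mul (hq x hx)).mul ((hg x).pow 2)
    refine h1.congr_deriv ?_
    simp only [hF', Pi.mul_apply, Pi.pow_apply]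
    norm_num
  have hintg : IntervalIntegrable F' volume a b := by
    apply ContinuousOn.intervalIntegrable
    rwa [Set.uIcc_of_le hab]
  have hftc := intervalIntegral.integral_eq_sub_of_hasDerivAt hF hintg
  have hz : w b * q b * g b ^ 2 - w a * q a * g a ^ 2 = 0 := by
    rcases ha with h | h <;> rcases hb with h' | h' <;> simp [h, h']
  rw [hz] at hftc
  have i1 : IntervalIntegrable (fun x => w x * g' x ^ 2) volume a b :=
    (by fun_prop : Continuous _).intervalIntegrable _ _
  have i2 : IntervalIntegrable (fun x => Λ * (w x * g x ^ 2)) volume a b :=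
    (by fun_prop : Continuous _).intervalIntegrable _ _
  have : ∫ x in a..b, w x * g' x ^ 2 = ∫ x in a..b, (w x * g' x ^ 2 - F' x) := by
    rw [intervalIntegral.integral_sub i1 hintg, hftc, sub_zero]
  rw [this, ← intervalIntegral.integral_const_mul]
  refine intervalIntegral.integral_mono_on hab i2 (i1.sub hintg) ?_
  intro x hx
  simp only [hF']
  have h1 := mul_nonneg (hw0 x hx) (sq_nonneg (g' x - q x * g x))
  have h2 := mul_le_mul_of_nonneg_right (hR x hx) (sq_nonneg (g x))
  nlinarith

/-- A smooth function in straightened coordinates, averaged over the slice. -/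
def avg {n : ℕ} (u : Euc (n + 1) → ℝ) (h : ℝ → ℝ) (x : ℝ) : ℝ :=
  ∫ z, u (JL n (x, h x • z)) ∂(muQ n)

lemma avg_hasDerivAt {n : ℕ} (u : Euc (n + 1) → ℝ) (hu : ContDiff ℝ 1 u) (α β x : ℝ) :
    HasDerivAt (avg u fun x => α + β * x)
      (∫ z, fderiv ℝ u (JL n (x, (α + β * x) • z)) (JL n (1, β • z)) ∂(muQ n)) x := by
  have hfd : Continuous (fderiv ℝ u) := hu.continuous_fderiv (by norm_num)
  have huc := hu.continuous
  set F' : ℝ → (Fin n → ℝ) → ℝ :=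
    fun x z => fderiv ℝ u (JL n (x, (α + β * x) • z)) (JL n (1, β • z)) with hF'
  have hF'c : Continuous (Function.uncurry F') := by
    simp only [Function.uncurry_def, hF']; fun_prop
  obtain ⟨M, hM⟩ := ((isCompact_Icc (a := x - 1) (b := x + 1)).prod
    (isCompact_cube n)).exists_bound_of_continuousOn hF'c.continuousOn
  have hd : ∀ y z, HasDerivAt (fun y => u (JL n (y, (α + β * y) • z))) (F' y z) y := by
    intro y z
    have h0 : HasDerivAt (fun y : ℝ => α + β * y) β y := by
      simpa using ((hasDerivAt_id y).const_mul β).const_add α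
    have h1 : HasDerivAt (fun y : ℝ => (y, (α + β * y) • z)) ((1 : ℝ), β • z) y :=
      (hasDerivAt_id y).prodMk (h0.smul_const z)
    have h2 := (JL n).hasFDerivAt.comp_hasDerivAt y h1
    exact ((hu.differentiable (by norm_num) _).hasFDerivAt).comp_hasDerivAt y h2
  refine (hasDerivAt_integral_of_dominated_loc_of_deriv_le (μ := muQ n)
    (F := fun y z => u (JL n (y, (α + β * y) • z))) (F' := F') (bound := fun _ => M)
    (s := Set.Icc (x - 1) (x + 1)) (Icc_mem_nhds (by linarith) (by linarith)) ?_ ?_ ?_ ?_ ?_ ?_).2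
  · exact Eventually.of_forall fun y =>
      (by fun_prop : Continuous fun z => u (JL n (y, (α + β * y) • z))).aestronglyMeasurable
  · exact integrable_muQ (by fun_prop)
  · exact (by fun_prop : Continuous (F' x)).aestronglyMeasurable
  · refine (ae_restrict_iff' (measurableSet_cube n)).2 (Eventually.of_forall fun z hz y hy => ?_)
    exact hM (y, z) ⟨hy, hz⟩
  · exact integrable_const _
  · exact Eventually.of_forall fun z y _ => hd y z

lemma slice_ineq {n : ℕ} (u : Euc (n + 1) → ℝ) (hu : ContDiff ℝ 1 u) (x r β ε ρ Λ : ℝ)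
    (hr0 : 0 ≤ r) (hrε : r ≤ ε) (hβ : |β| ≤ ε) (hρ0 : 0 < ρ) (hρ1 : ρ < 1) (hΛ : 0 ≤ Λ)
    (h1 : ρ * (1 + ε ^ 2 * n) ≤ 1) (h2 : ρ ^ 2 * Λ * (2 ^ n * (ε ^ 2 * n)) ≤ 1 - ρ) :
    ρ ^ 2 * (∫ z, fderiv ℝ u (JL n (x, r • z)) (JL n (1, β • z)) ∂(muQ n)) ^ 2 +
      ρ ^ 2 * Λ * (∫ z, u (JL n (x, r • z)) ^ 2 ∂(muQ n) - (∫ z, u (JL n (x, r • z)) ∂(muQ n)) ^ 2)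
    ≤ ∫ z, ‖fderiv ℝ u (JL n (x, r • z))‖ ^ 2 ∂(muQ n) := by
  have hfd : Continuous (fderiv ℝ u) := hu.continuous_fderiv (by norm_num)
  have huc := hu.continuous
  set A := ∫ z, ‖fderiv ℝ u (JL n (x, r • z))‖ ^ 2 ∂(muQ n) with hA
  have hA0 : 0 ≤ A := integral_nonneg fun z => by positivity
  have ε0 : 0 ≤ ε := hr0.trans hrε
  have ae_cube : ∀ {P : (Fin n → ℝ) → Prop}, (∀ z ∈ cube n, P z) → ∀ᵐ z ∂(muQ n), P z :=
    fun h => (ae_restrict_iff' (measurableSet_cube n)).2 (Eventually.of_forall h)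
  have s1 : (∫ z, fderiv ℝ u (JL n (x, r • z)) (JL n (1, β • z)) ∂(muQ n)) ^ 2 ≤ (1 + ε ^ 2 * n) * A := by
    refine (jensen_sq _ _ (integrable_muQ (by fun_prop)) (integrable_muQ (by fun_prop))).trans ?_
    rw [hA, ← integral_const_mul]
    refine integral_mono_ae (integrable_muQ (by fun_prop)) (integrable_muQ (by fun_prop)) ?_
    refine ae_cube fun z hz => ?_
    have b1 := (fderiv ℝ u (JL n (x, r • z))).le_opNorm (JL n (1, β • z))
    have b2 : ‖JL n (1, β • z)‖ ^ 2 ≤ 1 + ε ^ 2 * n := by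
      rw [JL_norm_sq]
      have : ∑ i, (β • z) i ^ 2 ≤ ∑ i : Fin n, ε ^ 2 := by
        refine Finset.sum_le_sum fun i _ => ?_
        have z0 := hz.1 i; have z1 := hz.2 i
        simp only [Pi.zero_apply, Pi.one_apply] at z0 z1
        rw [Pi.smul_apply, smul_eq_mul, mul_pow, ← sq_abs β]
        have : z i ^ 2 ≤ 1 := by nlinarith
        have : |β| ^ 2 ≤ ε ^ 2 := by gcongr
        nlinarith [sq_nonneg (z i), sq_nonneg |β|]
      simp at this ⊢
      linarith
    calc (fderiv ℝ u (JL n (x, r • z)) (JL n (1, β • z))) ^ 2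
        = ‖fderiv ℝ u (JL n (x, r • z)) (JL n (1, β • z))‖ ^ 2 := by simp
      _ ≤ (‖fderiv ℝ u (JL n (x, r • z))‖ * ‖JL n (1, β • z)‖) ^ 2 := by gcongr
      _ = ‖JL n (1, β • z)‖ ^ 2 * ‖fderiv ℝ u (JL n (x, r • z))‖ ^ 2 := by ring
      _ ≤ (1 + ε ^ 2 * n) * ‖fderiv ℝ u (JL n (x, r • z))‖ ^ 2 := by gcongr
  have hv : ContDiff ℝ 1 fun z => u (JL n (x, r • z)) := by fun_prop
  have s2 : ∫ z, u (JL n (x, r • z)) ^ 2 ∂(muQ n) - (∫ z, u (JL n (x, r • z)) ∂(muQ n)) ^ 2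
      ≤ 2 ^ n * (ε ^ 2 * n) * A := by
    rw [← variance_id _ _ (integrable_muQ (by fun_prop)) (integrable_muQ (by fun_prop))]
    refine (poincare _ hv).trans ?_
    rw [mul_assoc]
    gcongr
    rw [hA, ← integral_const_mul]
    have hvd : Continuous (fderiv ℝ fun z => u (JL n (x, r • z))) := hv.continuous_fderiv (by norm_num)
    refine integral_mono (integrable_muQ (by fun_prop)) (integrable_muQ (by fun_prop)) ?_
    intro z
    have hle : ‖fderiv ℝ (fun z => u (JL n (x, r • z))) z‖ ≤
        ‖fderiv ℝ u (JL n (x, r • z))‖ * √(ε ^ 2 * n) := by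
      refine ContinuousLinearMap.opNorm_le_bound _ (by positivity) fun ζ => ?_
      have d1 : HasFDerivAt (fun z : Fin n → ℝ => (x, r • z))
          ((0 : (Fin n → ℝ) →L[ℝ] ℝ).prod (r • ContinuousLinearMap.id ℝ (Fin n → ℝ))) z :=
        (hasFDerivAt_const x z).prodMk ((hasFDerivAt_id z).const_smul r)
      have d2 := ((hu.differentiable (by norm_num) (JL n (x, r • z))).hasFDerivAt).comp z
        ((JL n).hasFDerivAt.comp z d1)
      have d3 : fderiv ℝ (fun z => u (JL n (x, r • z))) z ζ =
          fderiv ℝ u (JL n (x, r • z)) (JL n (0, r • ζ)) := by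
        have e := d2.fderiv
        have e2 : (fun z => u (JL n (x, r • z))) = u ∘ (⇑(JL n) ∘ fun z => (x, r • z)) := rfl
        rw [e2, e]
        simp
      rw [d3]
      refine ((fderiv ℝ u (JL n (x, r • z))).le_opNorm _).trans ?_
      rw [mul_assoc]
      gcongr
      rw [← Real.sqrt_sq (norm_nonneg (JL n (0, r • ζ)))]
      rw [← Real.sqrt_sq (norm_nonneg ζ), ← Real.sqrt_mul (by positivity)]
      apply Real.sqrt_le_sqrt
      rw [JL_norm_sq]
      have : ∑ i, (r • ζ) i ^ 2 ≤ ∑ i : Fin n, ε ^ 2 * ‖ζ‖ ^ 2 := by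
        refine Finset.sum_le_sum fun i _ => ?_
        rw [Pi.smul_apply, smul_eq_mul, mul_pow]
        have := norm_le_pi_norm ζ i
        rw [← sq_abs (ζ i), ← Real.norm_eq_abs]
        gcongr
      simp at this ⊢
      linarith
    calc _ ≤ (‖fderiv ℝ u (JL n (x, r • z))‖ * √(ε ^ 2 * n)) ^ 2 := by
            show ‖fderiv ℝ (fun z => u (JL n (x, r • z))) z‖ ^ 2 ≤ _
            gcongr
      _ = _ := by rw [mul_pow, Real.sq_sqrt (by positivity)]; ring
  have t1 : ρ ^ 2 * (∫ z, fderiv ℝ u (JL n (x, r • z)) (JL n (1, β • z)) ∂(muQ n)) ^ 2 ≤ ρ * A := by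
    calc _ ≤ ρ ^ 2 * ((1 + ε ^ 2 * n) * A) := by gcongr
      _ = ρ * ((ρ * (1 + ε ^ 2 * n)) * A) := by ring
      _ ≤ ρ * (1 * A) := by gcongr
      _ = _ := by ring
  have t2 : ρ ^ 2 * Λ * (∫ z, u (JL n (x, r • z)) ^ 2 ∂(muQ n) - (∫ z, u (JL n (x, r • z)) ∂(muQ n)) ^ 2)
      ≤ (1 - ρ) * A := by
    calc _ ≤ ρ ^ 2 * Λ * (2 ^ n * (ε ^ 2 * n) * A) := by gcongr
      _ = (ρ ^ 2 * Λ * (2 ^ n * (ε ^ 2 * n))) * A := by ring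
      _ ≤ _ := by gcongr
  linarith

/-- The slice-weighted integral of `f`. -/
def slw {n : ℕ} (f : Euc (n + 1) → ℝ) (h : ℝ → ℝ) (x : ℝ) : ℝ :=
  h x ^ n * ∫ z, f (JL n (x, h x • z)) ∂(muQ n)

lemma slw_cont {n : ℕ} (f : Euc (n + 1) → ℝ) (h : ℝ → ℝ) (hf : Continuous f) (hh : Continuous h) :
    Continuous (slw f h) := by
  unfold slw
  refine (hh.pow n).mul (cont_param (fun x z => f (JL n (x, h x • z))) ?_)
  simp only [Function.uncurry_def]; fun_prop

lemma piece {n : ℕ} (u : Euc (n + 1) → ℝ) (hu : ContDiff ℝ 1 u) (a b α β ε ρ Λ : ℝ)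
    (hab : a ≤ b) (hh0 : ∀ x ∈ Set.Icc a b, 0 ≤ α + β * x)
    (hhε : ∀ x ∈ Set.Icc a b, α + β * x ≤ ε) (hβ : |β| ≤ ε)
    (hρ0 : 0 < ρ) (hρ1 : ρ < 1) (hΛ : 0 ≤ Λ)
    (h1 : ρ * (1 + ε ^ 2 * n) ≤ 1) (h2 : ρ ^ 2 * Λ * (2 ^ n * (ε ^ 2 * n)) ≤ 1 - ρ)
    (q q' : ℝ → ℝ)
    (hq : ∀ x ∈ Set.Icc a b, HasDerivAt q (q' x) x) (hq'c : ContinuousOn q' (Set.Icc a b))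
    (hR : ∀ x ∈ Set.Icc a b, (n * (α + β * x) ^ (n - 1) * β) * q x + (α + β * x) ^ n * q' x
      + (α + β * x) ^ n * q x ^ 2 ≤ -(Λ * (α + β * x) ^ n))
    (ha : (α + β * a) ^ n = 0 ∨ avg u (fun x => α + β * x) a = 0)
    (hb : (α + β * b) ^ n = 0 ∨ avg u (fun x => α + β * x) b = 0) :
    ρ ^ 2 * Λ * (∫ x in a..b, slw (fun p => u p ^ 2) (fun x => α + β * x) x) ≤
      ∫ x in a..b, slw (fun p => ‖fderiv ℝ u p‖ ^ 2) (fun x => α + β * x) x := by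
  have hfd : Continuous (fderiv ℝ u) := hu.continuous_fderiv (by norm_num)
  have huc := hu.continuous
  set h : ℝ → ℝ := fun x => α + β * x with hh
  have hhc : Continuous h := by fun_prop
  set g' : ℝ → ℝ := fun x => ∫ z, fderiv ℝ u (JL n (x, h x • z)) (JL n (1, β • z)) ∂(muQ n) with hg'
  have hg'c : Continuous g' := by
    refine cont_param (fun x z => fderiv ℝ u (JL n (x, h x • z)) (JL n (1, β • z))) ?_
    simp only [Function.uncurry_def]; fun_prop
  have hg : ∀ x, HasDerivAt (avg u h) (g' x) x := fun x => avg_hasDerivAt u hu α β x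
  have hgc : Continuous (avg u h) := continuous_iff_continuousAt.2 fun x => (hg x).continuousAt
  have hw : ∀ x, HasDerivAt (fun x => h x ^ n) (n * h x ^ (n - 1) * β) x := by
    intro x
    have h0 : HasDerivAt h β x := by
      have := ((hasDerivAt_id x).const_mul β).const_add α
      rw [mul_one] at this
      exact this
    exact h0.pow n
  have hric := riccati a b Λ hab (fun x => h x ^ n) (fun x => n * h x ^ (n - 1) * β) q q' (avg u h) g'
    hw (by fun_prop) hq hq'c hg hg'c (fun x hx => pow_nonneg (hh0 x hx) n) hR ha hb
  have c1 := slw_cont (fun p => u p ^ 2) h (by fun_prop) hhc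
  have c2 := slw_cont (fun p => ‖fderiv ℝ u p‖ ^ 2) h (by fun_prop) hhc
  have i1 : IntervalIntegrable (fun x => ρ ^ 2 * (h x ^ n * g' x ^ 2)) volume a b :=
    (by fun_prop : Continuous _).intervalIntegrable _ _
  have i2 : IntervalIntegrable (fun x => ρ ^ 2 * Λ * (h x ^ n * avg u h x ^ 2)) volume a b :=
    (by fun_prop : Continuous _).intervalIntegrable _ _
  have i3 : IntervalIntegrable (fun x => ρ ^ 2 * Λ * slw (fun p => u p ^ 2) h x) volume a b :=
    (by fun_prop : Continuous _).intervalIntegrable _ _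
  have hmono : ∫ x in a..b, (ρ ^ 2 * (h x ^ n * g' x ^ 2) + (ρ ^ 2 * Λ * slw (fun p => u p ^ 2) h x
      - ρ ^ 2 * Λ * (h x ^ n * avg u h x ^ 2))) ≤
      ∫ x in a..b, slw (fun p => ‖fderiv ℝ u p‖ ^ 2) h x := by
    refine intervalIntegral.integral_mono_on hab (i1.add (i3.sub i2)) (c2.intervalIntegrable _ _) ?_
    intro x hx
    have := mul_le_mul_of_nonneg_left (slice_ineq u hu x (h x) β ε ρ Λ (hh0 x hx) (hhε x hx) hβ hρ0 hρ1 hΛ h1 h2)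
      (pow_nonneg (hh0 x hx) n)
    simp only [slw, avg, hg']
    refine le_trans (le_of_eq ?_) this
    ring
  rw [intervalIntegral.integral_add i1 (i3.sub i2), intervalIntegral.integral_sub i3 i2,
    intervalIntegral.integral_const_mul, intervalIntegral.integral_const_mul,
    intervalIntegral.integral_const_mul] at hmono
  have := mul_le_mul_of_nonneg_left hric (sq_nonneg ρ)
  linarith

/-- Logarithmic derivative of the cone supersolution. -/
def qcone (s X : ℝ) : ℝ := 2 * X * (-(1 - X ^ 2)⁻¹ - (s - 1 / 5) - 1 / 5 * X ^ 2)

/-- Its derivative. -/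
def qcone' (s X : ℝ) : ℝ :=
  2 * (-(1 - X ^ 2)⁻¹ - (s - 1 / 5) - 1 / 5 * X ^ 2) +
    2 * X * (-(2 * X) / (1 - X ^ 2) ^ 2 - 2 / 5 * X)

lemma qcone_deriv (s X : ℝ) (hX : 0 < 1 - X ^ 2) : HasDerivAt (qcone s) (qcone' s X) X := by
  have h1 : HasDerivAt (fun X : ℝ => 1 - X ^ 2) (-(2 * X)) X := by
    have := (hasDerivAt_pow 2 X).const_sub 1
    simpa using this
  have h2 := (((h1.inv hX.ne').neg.sub_const (s - 1 / 5)).sub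
    ((hasDerivAt_pow 2 X).const_mul (1 / 5)))
  have h3 := ((hasDerivAt_id X).const_mul 2).mul h2
  refine h3.congr_deriv ?_
  simp only [qcone', id, Pi.sub_apply, Pi.neg_apply, Pi.inv_apply]
  field_simp
  push_cast
  ring

lemma qcone'_cont (s : ℝ) (ρ : ℝ) (hρ : ρ < 1) : ContinuousOn (qcone' s) (Set.Icc 0 ρ) := by
  have : ∀ X ∈ Set.Icc 0 ρ, 1 - X ^ 2 ≠ 0 := by
    intro X hX
    have := hX.1; have := hX.2
    nlinarith
  have h2 : ∀ X ∈ Set.Icc 0 ρ, (1 - X ^ 2) ^ 2 ≠ 0 := fun X hX => pow_ne_zero 2 (this X hX)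
  unfold qcone'
  fun_prop (disch := assumption)

lemma cone_poly (s t : ℝ) (hs : 1 ≤ s) (ht0 : 0 ≤ t) (ht1 : t ≤ 1) :
    (s + 83 / 100) ^ 2 ≤ 2 * s + 3 / 5 * t + 2 * s * (s - 1 / 5 * (1 - t))
      - t * (s - 1 / 5 * (1 - t)) ^ 2 := by
  obtain ⟨r, rfl⟩ : ∃ r, t = 1 - r := ⟨1 - t, by ring⟩
  have hr0 : 0 ≤ r := by linarith
  have hr1 : r ≤ 1 := by linarith
  have e : 2 * s + 3 / 5 * (1 - r) + 2 * s * (s - 1 / 5 * (1 - (1 - r)))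
      - (1 - r) * (s - 1 / 5 * (1 - (1 - r))) ^ 2 - (s + 83 / 100) ^ 2
      = (1 - r) * (34 / 100 * s - 889 / 10000) + r * (s ^ 2 - 6 / 100 * s - 6889 / 10000)
        + (2 / 5 * s + 1 / 25) * (r * (1 - r)) - 1 / 25 * (r * (1 - r)) * (1 + r) := by
    ring
  have p1 : 0 ≤ r * (1 - r) := mul_nonneg hr0 (by linarith)
  have p2 : 0 ≤ (1 - r) * (34 / 100 * s - 889 / 10000) := mul_nonneg (by linarith) (by linarith)
  have p3 : 0 ≤ r * (s ^ 2 - 6 / 100 * s - 6889 / 10000) := mul_nonneg hr0 (by nlinarith)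
  nlinarith

lemma qcone_ineq (n : ℕ) (s X : ℝ) (hs : 1 ≤ s) (hn : (n : ℝ) + 1 = 4 * s) (hX0 : 0 ≤ X) (hX1 : X < 1) :
    n * qcone s X + X * (qcone' s X + qcone s X ^ 2) ≤ - ((2 * s + 83 / 50) ^ 2 * X) := by
  have hpos : 0 < 1 - X ^ 2 := by nlinarith
  have hn' : (n : ℝ) = 4 * s - 1 := by linarith
  have key := cone_poly s (X ^ 2) hs (sq_nonneg X) (by linarith)
  have e : n * qcone s X + X * (qcone' s X + qcone s X ^ 2) = - (4 * X * (2 * s + 3 / 5 * X ^ 2 + 2 * s * (s - 1 / 5 * (1 - X ^ 2))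
      - X ^ 2 * (s - 1 / 5 * (1 - X ^ 2)) ^ 2)) := by
    rw [hn']
    unfold qcone qcone'
    field_simp
    ring
  rw [e]
  have := mul_le_mul_of_nonneg_left key (by linarith : 0 ≤ 4 * X)
  nlinarith

/-- Height profile. -/
def prof (ε ρ L x : ℝ) : ℝ := ε * min x (min ρ (L - x))

lemma prof_cont (ε ρ L : ℝ) : Continuous (prof ε ρ L) := by unfold prof; fun_prop

lemma prof_concave (ε ρ L : ℝ) (hε : 0 ≤ ε) : ConcaveOn ℝ Set.univ (prof ε ρ L) := by
  have h1 : ConcaveOn ℝ Set.univ (fun x : ℝ => x) := concaveOn_id convex_univ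
  have h2 : ConcaveOn ℝ Set.univ (fun _ : ℝ => ρ) := concaveOn_const _ convex_univ
  have h3 : ConcaveOn ℝ Set.univ (fun x : ℝ => L - x) :=
    (concaveOn_const L convex_univ).sub (convexOn_id convex_univ)
  exact (h1.inf (h2.inf h3)).smul hε

lemma left_piece {n : ℕ} (u : Euc (n + 1) → ℝ) (hu : ContDiff ℝ 1 u) (ε ρ s : ℝ) (hs : 1 ≤ s)
    (hn : (n : ℝ) + 1 = 4 * s) (hn1 : 1 ≤ n) (hε : 0 < ε)
    (hρ0 : 0 < ρ) (hρ1 : ρ < 1)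
    (h1 : ρ * (1 + ε ^ 2 * n) ≤ 1)
    (h2 : ρ ^ 2 * (2 * s + 83 / 50) ^ 2 * (2 ^ n * (ε ^ 2 * n)) ≤ 1 - ρ)
    (hb : avg u (fun x => 0 + ε * x) ρ = 0) :
    ρ ^ 2 * (2 * s + 83 / 50) ^ 2 * (∫ x in (0:ℝ)..ρ, slw (fun p => u p ^ 2) (fun x => 0 + ε * x) x) ≤
      ∫ x in (0:ℝ)..ρ, slw (fun p => ‖fderiv ℝ u p‖ ^ 2) (fun x => 0 + ε * x) x := by
  refine piece u hu 0 ρ 0 ε ε ρ _ hρ0.le ?_ ?_ (abs_of_pos hε).le hρ0 hρ1 (sq_nonneg _) h1 h2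
    (qcone s) (qcone' s) ?_ (qcone'_cont s ρ hρ1) ?_ ?_ (Or.inr hb)
  · intro x hx; have := hx.1; positivity
  · intro x hx; nlinarith [hx.1, hx.2]
  · intro x hx
    exact qcone_deriv s x (by nlinarith [hx.1, hx.2])
  · intro x hx
    have key := qcone_ineq n s x hs hn hx.1 (by linarith [hx.2])
    have hx0 := hx.1
    obtain ⟨m, rfl⟩ : ∃ m, n = m + 1 := ⟨n - 1, by omega⟩
    simp only [Nat.add_sub_cancel, zero_add]
    have := mul_le_mul_of_nonneg_left key (by positivity : 0 ≤ (ε * x) ^ m * ε)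
    rw [pow_succ]
    nlinarith
  · left; simp; omega

lemma right_piece {n : ℕ} (u : Euc (n + 1) → ℝ) (hu : ContDiff ℝ 1 u) (ε ρ s L : ℝ) (hs : 1 ≤ s)
    (hn : (n : ℝ) + 1 = 4 * s) (hn1 : 1 ≤ n) (hε : 0 < ε)
    (hρ0 : 0 < ρ) (hρ1 : ρ < 1)
    (h1 : ρ * (1 + ε ^ 2 * n) ≤ 1)
    (h2 : ρ ^ 2 * (2 * s + 83 / 50) ^ 2 * (2 ^ n * (ε ^ 2 * n)) ≤ 1 - ρ)
    (hb : avg u (fun x => ε * L + (-ε) * x) (L - ρ) = 0) :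
    ρ ^ 2 * (2 * s + 83 / 50) ^ 2 * (∫ x in (L - ρ)..L, slw (fun p => u p ^ 2) (fun x => ε * L + (-ε) * x) x) ≤
      ∫ x in (L - ρ)..L, slw (fun p => ‖fderiv ℝ u p‖ ^ 2) (fun x => ε * L + (-ε) * x) x := by
  refine piece u hu (L - ρ) L (ε * L) (-ε) ε ρ _ (by linarith) ?_ ?_ (by rw [abs_neg, abs_of_pos hε]) hρ0 hρ1 (sq_nonneg _) h1 h2
    (fun x => -qcone s (L - x)) (fun x => qcone' s (L - x)) ?_ ?_ ?_ (Or.inr hb) ?_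
  · intro x hx; nlinarith [hx.1, hx.2]
  · intro x hx; nlinarith [hx.1, hx.2]
  · intro x hx
    have h := qcone_deriv s (L - x) (by nlinarith [hx.1, hx.2])
    have h' := (h.comp x ((hasDerivAt_id x).const_sub L)).neg
    refine h'.congr_deriv ?_
    ring
  · refine (qcone'_cont s ρ hρ1).comp (by fun_prop) ?_
    intro x hx
    exact ⟨by linarith [hx.2], by linarith [hx.1]⟩
  · intro x hx
    obtain ⟨X, rfl⟩ : ∃ X, x = L - X := ⟨L - x, by ring⟩
    have hX0 : 0 ≤ X := by linarith [hx.2]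
    have key := qcone_ineq n s X hs hn hX0 (by linarith [hx.1])
    obtain ⟨m, rfl⟩ : ∃ m, n = m + 1 := ⟨n - 1, by omega⟩
    have e1 : ε * L + -ε * (L - X) = ε * X := by ring
    have e2 : L - (L - X) = X := by ring
    simp only [Nat.add_sub_cancel, e1, e2]
    have := mul_le_mul_of_nonneg_left key (by positivity : 0 ≤ (ε * X) ^ m * ε)
    rw [pow_succ]
    nlinarith
  · left
    have : ε * L + -ε * L = 0 := by ring
    rw [this]
    exact zero_pow (by omega)

lemma mid_piece {n : ℕ} (u : Euc (n + 1) → ℝ) (hu : ContDiff ℝ 1 u) (ε ρ S a : ℝ) (hS : 0 < S)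
    (hε : 0 < ε)
    (hρ0 : 0 < ρ) (hρ1 : ρ < 1)
    (h1 : ρ * (1 + ε ^ 2 * n) ≤ 1)
    (h2 : ρ ^ 2 * S ^ 2 * (2 ^ n * (ε ^ 2 * n)) ≤ 1 - ρ)
    (ha : avg u (fun x => ε * ρ + 0 * x) a = 0)
    (hb : avg u (fun x => ε * ρ + 0 * x) (a + ρ * π / S) = 0) :
    ρ ^ 2 * S ^ 2 * (∫ x in a..(a + ρ * π / S), slw (fun p => u p ^ 2) (fun x => ε * ρ + 0 * x) x) ≤
      ∫ x in a..(a + ρ * π / S), slw (fun p => ‖fderiv ℝ u p‖ ^ 2) (fun x => ε * ρ + 0 * x) x := by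
  have hℓ : 0 < ρ * π / S := by positivity
  set c := a + ρ * π / S / 2 with hc
  have hcos : ∀ x ∈ Set.Icc a (a + ρ * π / S), 0 < cos (S * (x - c)) := by
    intro x hx
    have e : S * (ρ * π / S / 2) = ρ * π / 2 := by field_simp
    have hpi : ρ * π / 2 < π / 2 := by nlinarith [Real.pi_pos]
    have h1 : S * (x - c) ≤ S * (ρ * π / S / 2) :=
      mul_le_mul_of_nonneg_left (by linarith [hx.2]) hS.le
    have h2 : S * (-(ρ * π / S / 2)) ≤ S * (x - c) :=
      mul_le_mul_of_nonneg_left (by linarith [hx.1]) hS.le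
    exact Real.cos_pos_of_mem_Ioo ⟨by linarith, by linarith⟩
  refine piece u hu a _ (ε * ρ) 0 ε ρ (S ^ 2) (by linarith) ?_ ?_ (by simpa using hε.le) hρ0 hρ1 (sq_nonneg _) h1 h2
    (fun x => -S * tan (S * (x - c))) (fun x => -S ^ 2 / cos (S * (x - c)) ^ 2) ?_ ?_ ?_ (Or.inr ha) (Or.inr hb)
  · intro x hx; nlinarith
  · intro x hx; nlinarith
  · intro x hx
    have h0 : HasDerivAt (fun x => S * (x - c)) S x := by
      have := ((hasDerivAt_id x).sub_const c).const_mul S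
      rw [mul_one] at this
      exact this
    have h := ((Real.hasDerivAt_tan (hcos x hx).ne').comp x h0).const_mul (-S)
    refine h.congr_deriv ?_
    ring
  · have : ∀ x ∈ Set.Icc a (a + ρ * π / S), cos (S * (x - c)) ^ 2 ≠ 0 := fun x hx => by
      have := hcos x hx; positivity
    fun_prop (disch := assumption)
  · intro x hx
    have h := hcos x hx
    have e : -S ^ 2 / cos (S * (x - c)) ^ 2 + (-S * tan (S * (x - c))) ^ 2 = - S ^ 2 := by
      rw [Real.tan_eq_sin_div_cos]
      have := Real.sin_sq_add_cos_sq (S * (x - c))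
      field_simp
      nlinarith
    simp only [zero_mul, mul_zero, add_zero, zero_add]
    rw [← mul_add, e]
    apply le_of_eq; ring

lemma lower {n : ℕ} (u : Euc (n + 1) → ℝ) (hu : ContDiff ℝ 1 u) (m : ℕ) (ε ρ s L : ℝ) (hs : 1 ≤ s)
    (hn : (n : ℝ) + 1 = 4 * s) (hn1 : 1 ≤ n) (hε : 0 < ε)
    (hρ0 : 0 < ρ) (hρ1 : ρ < 1)
    (h1 : ρ * (1 + ε ^ 2 * n) ≤ 1)
    (h2 : ρ ^ 2 * (2 * s + 83 / 50) ^ 2 * (2 ^ n * (ε ^ 2 * n)) ≤ 1 - ρ)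
    (hL : L = 2 * ρ + m * (ρ * π / (2 * s + 83 / 50)))
    (hz : ∀ i ≤ m, avg u (prof ε ρ L) (ρ + i * (ρ * π / (2 * s + 83 / 50))) = 0) :
    ρ ^ 2 * (2 * s + 83 / 50) ^ 2 * (∫ x in (0:ℝ)..L, slw (fun p => u p ^ 2) (prof ε ρ L) x) ≤
      ∫ x in (0:ℝ)..L, slw (fun p => ‖fderiv ℝ u p‖ ^ 2) (prof ε ρ L) x := by
  have hfd : Continuous (fderiv ℝ u) := hu.continuous_fderiv (by norm_num)
  have huc := hu.continuous
  set S := 2 * s + 83 / 50 with hS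
  have hS0 : 0 < S := by linarith
  set ℓ := ρ * π / S with hℓ
  have hℓ0 : 0 < ℓ := by positivity
  set b : ℕ → ℝ := fun i => ρ + i * ℓ with hb
  have hb0 : b 0 = ρ := by simp [hb]
  have hbm : b m = L - ρ := by simp only [hb]; linarith
  have hbs : ∀ i, b (i + 1) = b i + ℓ := fun i => by simp only [hb]; push_cast; ring
  have hmℓ : 0 ≤ m * ℓ := by positivity
  -- affine formulas
  have pl : ∀ x ∈ Set.uIcc 0 ρ, prof ε ρ L x = 0 + ε * x := by
    intro x hx
    rw [Set.uIcc_of_le hρ0.le] at hx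
    rw [prof, min_eq_left, zero_add]
    exact le_min hx.2 (by linarith [hx.2])
  have pr : ∀ x ∈ Set.uIcc (L - ρ) L, prof ε ρ L x = ε * L + (-ε) * x := by
    intro x hx
    rw [Set.uIcc_of_le (by linarith)] at hx
    rw [prof, min_eq_right (a := ρ) (by linarith [hx.1]), min_eq_right (by linarith [hx.1])]
    ring
  have pm : ∀ x ∈ Set.Icc ρ (L - ρ), prof ε ρ L x = ε * ρ + 0 * x := by
    intro x hx
    rw [prof, min_eq_left (a := ρ) (by linarith [hx.2]), min_eq_right hx.1]
    ring
  have savg : ∀ (h h' : ℝ → ℝ) (x : ℝ), h x = h' x → avg u h x = 0 → avg u h' x = 0 := by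
    intro h h' x e; unfold avg; rw [e]; exact id
  have cong : ∀ (f : Euc (n + 1) → ℝ) (a c : ℝ) (h h' : ℝ → ℝ), (∀ x ∈ Set.uIcc a c, h x = h' x) →
      ∫ x in a..c, slw f h x = ∫ x in a..c, slw f h' x := by
    intro f a c h h' e
    apply intervalIntegral.integral_congr
    intro x hx
    simp only [slw, e x hx]
  -- splitting
  have split : ∀ f : Euc (n + 1) → ℝ, Continuous f → ∫ x in (0:ℝ)..L, slw f (prof ε ρ L) x =
      (∫ x in (0:ℝ)..ρ, slw f (fun x => 0 + ε * x) x) +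
      (∑ i ∈ Finset.range m, ∫ x in (b i)..(b i + ℓ), slw f (fun x => ε * ρ + 0 * x) x) +
      ∫ x in (L - ρ)..L, slw f (fun x => ε * L + (-ε) * x) x := by
    intro f hf
    have hc := slw_cont f (prof ε ρ L) hf (prof_cont ε ρ L)
    have hii : ∀ a c, IntervalIntegrable (slw f (prof ε ρ L)) volume a c := fun a c =>
      hc.intervalIntegrable a c
    rw [← cong f 0 ρ _ _ pl, ← cong f _ _ _ _ pr]
    have hmid : (∑ i ∈ Finset.range m, ∫ x in (b i)..(b i + ℓ), slw f (fun x => ε * ρ + 0 * x) x) =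
        ∫ x in ρ..(L - ρ), slw f (prof ε ρ L) x := by
      have e0 : ∫ x in ρ..(L - ρ), slw f (prof ε ρ L) x = ∫ x in (b 0)..(b m), slw f (prof ε ρ L) x := by
        rw [hb0, hbm]
      rw [e0, ← intervalIntegral.sum_integral_adjacent_intervals (fun i _ => hii _ _)]
      refine Finset.sum_congr rfl fun i hi => ?_
      rw [hbs]
      refine (cong f _ _ _ _ fun x hx => ?_).symm
      rw [Set.uIcc_of_le (by linarith)] at hx
      refine pm x ⟨?_, ?_⟩
      · have : 0 ≤ i * ℓ := by positivity
        have := hx.1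
        simp only [hb] at this
        linarith
      · have h3 : ((i : ℝ) + 1) * ℓ ≤ m * ℓ := by
          have : i + 1 ≤ m := Finset.mem_range.1 hi
          gcongr
          exact_mod_cast this
        have := hx.2
        simp only [hb] at this
        linarith
    rw [hmid, intervalIntegral.integral_add_adjacent_intervals (hii _ _) (hii _ _),
      intervalIntegral.integral_add_adjacent_intervals (hii _ _) (hii _ _)]
  rw [split _ (by fun_prop), split _ (by fun_prop), mul_add, mul_add, Finset.mul_sum]
  refine add_le_add (add_le_add ?_ (Finset.sum_le_sum fun i hi => ?_)) ?_
  · refine left_piece u hu ε ρ s hs hn hn1 hε hρ0 hρ1 h1 h2 ?_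
    refine savg _ _ _ (pl ρ Set.right_mem_uIcc) ?_
    simpa using hz 0 (Nat.zero_le _)
  · have him : i + 1 ≤ m := Finset.mem_range.1 hi
    have inIcc : ∀ j ≤ m, b j ∈ Set.Icc ρ (L - ρ) := by
      intro j hj
      have : 0 ≤ j * ℓ := by positivity
      have h3 : (j : ℝ) * ℓ ≤ m * ℓ := by gcongr
      simp only [hb]
      constructor <;> linarith
    refine mid_piece u hu ε ρ S (b i) hS0 hε hρ0 hρ1 h1 h2 ?_ ?_
    · exact savg _ _ _ (pm _ (inIcc i (by omega))) (hz i (by omega))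
    · rw [← hℓ, ← hbs]
      exact savg _ _ _ (pm _ (inIcc (i + 1) him)) (hz (i + 1) him)
  · refine right_piece u hu ε ρ s L hs hn hn1 hε hρ0 hρ1 h1 h2 ?_
    refine savg _ _ _ (pr _ Set.left_mem_uIcc) ?_
    rw [← hbm]
    exact hz m le_rfl

lemma int_sq_pos {d : ℕ} {Ω : Set (Euc d)} (ho : IsOpen Ω) (hb : Bornology.IsBounded Ω)
    (u : Euc d → ℝ) (hu : Continuous u) (hx : ∃ x ∈ Ω, u x ≠ 0) : 0 < ∫ x in Ω, u x ^ 2 := by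
  rw [setIntegral_pos_iff_support_of_nonneg_ae (Eventually.of_forall fun x => sq_nonneg _)
    (integrableOn_bounded hb (by fun_prop))]
  obtain ⟨x, hx, hux⟩ := hx
  have hopen : IsOpen (Function.support (fun x => u x ^ 2) ∩ Ω) :=
    (isOpen_ne.preimage (by fun_prop : Continuous fun x => u x ^ 2)).inter ho
  exact hopen.measure_pos volume ⟨x, by simpa using hux, hx⟩

lemma neumann_lower {d k : ℕ} {Ω : Set (Euc d)} (ho : IsOpen Ω) (hb : Bornology.IsBounded Ω)
    (B : ℝ)
    (hne : ∃ V : Submodule ℝ (Euc d → ℝ), (∀ u ∈ V, ContDiff ℝ (⊤ : ℕ∞) u) ∧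
      Module.finrank ℝ (V.map (LinearMap.funLeft ℝ ℝ ((↑) : Ω → Euc d))) = k + 1)
    (φ : (Euc d → ℝ) → Fin k → ℝ)
    (hφadd : ∀ u v, Continuous u → Continuous v → φ (u + v) = φ u + φ v)
    (hφsmul : ∀ (c : ℝ) u, Continuous u → φ (c • u) = c • φ u)
    (H : ∀ u, ContDiff ℝ (⊤ : ℕ∞) u → φ u = 0 →
      B * ∫ x in Ω, u x ^ 2 ≤ ∫ x in Ω, ‖fderiv ℝ u x‖ ^ 2) :
    B ≤ neumannEigenvalue k Ω := by
  obtain ⟨V0, hV0, hV0f⟩ := hne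
  refine le_csInf ⟨_, V0, hV0, hV0f, rfl⟩ ?_
  rintro t ⟨V, hV, hVf, rfl⟩
  set W := V.map (LinearMap.funLeft ℝ ℝ ((↑) : Ω → Euc d)) with hW
  have : Module.Finite ℝ W := Module.finite_of_finrank_pos (by omega)
  let bs := Module.finBasisOfFinrankEq ℝ W hVf
  have hex : ∀ j, ∃ u ∈ V, LinearMap.funLeft ℝ ℝ ((↑) : Ω → Euc d) u = bs j := fun j => (bs j).2
  choose u huV hur using hex
  let U : (Fin (k + 1) → ℝ) →ₗ[ℝ] (Euc d → ℝ) := Fintype.linearCombination ℝ u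
  have hU : ∀ c, U c = ∑ j, c j • u j := fun c => Fintype.linearCombination_apply _ _ _
  have hUV : ∀ c, U c ∈ V := fun c => by
    rw [hU]; exact V.sum_mem fun j _ => V.smul_mem _ (huV j)
  have hUsm : ∀ c, ContDiff ℝ (⊤ : ℕ∞) (U c) := fun c => hV _ (hUV c)
  have hUc : ∀ c, Continuous (U c) := fun c => (hUsm c).continuous
  have husm : ∀ j, ContDiff ℝ (⊤ : ℕ∞) (u j) := fun j => hV _ (huV j)
  have huc : ∀ j, Continuous (u j) := fun j => (husm j).continuous
  have hrestr : ∀ c, LinearMap.funLeft ℝ ℝ ((↑) : Ω → Euc d) (U c) = (∑ j, c j • bs j : W) := by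
    intro c
    rw [hU, map_sum]
    simp only [map_smul, hur, Submodule.coe_sum, Submodule.coe_smul]
  have hpos : ∀ c, c ≠ 0 → 0 < ∫ x in Ω, (U c x) ^ 2 := by
    intro c hc
    apply int_sq_pos ho hb _ (hUc c)
    by_contra! hcon
    apply hc
    have h0 : LinearMap.funLeft ℝ ℝ ((↑) : Ω → Euc d) (U c) = 0 := by
      ext x
      exact hcon x x.2
    rw [hrestr] at h0
    have h1 : ∑ j, c j • bs j = 0 := Subtype.ext h0
    have := Fintype.linearIndependent_iff.1 bs.linearIndependent c h1
    funext j; exact this j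
  -- every element of V agrees on Ω with some U c
  have hrep : ∀ v ∈ V, ∃ c, ∀ x ∈ Ω, v x = U c x := by
    intro v hv
    let w : W := ⟨LinearMap.funLeft ℝ ℝ ((↑) : Ω → Euc d) v, v, hv, rfl⟩
    refine ⟨fun j => bs.repr w j, fun x hx => ?_⟩
    have h1 := hrestr (fun j => bs.repr w j)
    rw [bs.sum_repr] at h1
    have := congrFun h1 ⟨x, hx⟩
    exact this.symm
  -- N is continuous
  have hNc : Continuous fun c => ∫ x in Ω, (U c x) ^ 2 := by
    have e : ∀ c, ∫ x in Ω, (U c x) ^ 2 = ∑ i, ∑ j, c i * c j * ∫ x in Ω, u i x * u j x := by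
      intro c
      have : ∀ x, (U c x) ^ 2 = ∑ i, ∑ j, c i * c j * (u i x * u j x) := by
        intro x
        rw [hU]
        simp only [Finset.sum_apply, Pi.smul_apply, smul_eq_mul]
        rw [sq, Finset.sum_mul_sum]
        refine Finset.sum_congr rfl fun i _ => Finset.sum_congr rfl fun j _ => by ring
      simp_rw [this]
      rw [integral_finsetSum _ fun i _ => integrable_finsetSum _ fun j _ =>
        integrableOn_bounded hb (by have := huc i; have := huc j; fun_prop)]
      refine Finset.sum_congr rfl fun i _ => ?_
      rw [integral_finsetSum _ fun j _ =>
        integrableOn_bounded hb (by have := huc i; have := huc j; fun_prop)]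
      refine Finset.sum_congr rfl fun j _ => ?_
      rw [integral_const_mul]
    simp_rw [e]
    fun_prop
  obtain ⟨c0, hc0, hmin⟩ := (isCompact_sphere (0 : Fin (k + 1) → ℝ) 1).exists_isMinOn
    (NormedSpace.sphere_nonempty.2 zero_le_one) hNc.continuousOn
  set m := ∫ x in Ω, (U c0 x) ^ 2 with hm
  have hm0 : 0 < m := hpos c0 (by
    rintro rfl
    simp at hc0)
  have hNlow : ∀ c, ‖c‖ ^ 2 * m ≤ ∫ x in Ω, (U c x) ^ 2 := by
    intro c
    by_cases hc : c = 0
    · subst hc; simp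
    have hcn : 0 < ‖c‖ := norm_pos_iff.2 hc
    have hs : ‖c‖⁻¹ • c ∈ Metric.sphere (0 : Fin (k + 1) → ℝ) 1 := by
      simp [norm_smul, hcn.ne']
    have h1 : m ≤ ∫ x in Ω, (U (‖c‖⁻¹ • c) x) ^ 2 := hmin hs
    have e : ∫ x in Ω, (U (‖c‖⁻¹ • c) x) ^ 2 = (‖c‖⁻¹) ^ 2 * ∫ x in Ω, (U c x) ^ 2 := by
      rw [← integral_const_mul]
      congr 1; ext x
      rw [map_smul, Pi.smul_apply, smul_eq_mul, mul_pow]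
    rw [e] at h1
    calc ‖c‖ ^ 2 * m ≤ ‖c‖ ^ 2 * ((‖c‖⁻¹) ^ 2 * ∫ x in Ω, (U c x) ^ 2) := by gcongr
      _ = _ := by field_simp
  set M := ∫ x in Ω, (∑ j, ‖fderiv ℝ (u j) x‖) ^ 2 with hM
  have hM0 : 0 ≤ M := integral_nonneg fun x => sq_nonneg _
  have hDup : ∀ c, ∫ x in Ω, ‖fderiv ℝ (U c) x‖ ^ 2 ≤ ‖c‖ ^ 2 * M := by
    intro c
    rw [hM, ← integral_const_mul]
    have hcj : ∀ j, Continuous (fderiv ℝ (u j)) := fun j => (husm j).continuous_fderiv (by simp)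
    have hcc : Continuous (fderiv ℝ (U c)) := (hUsm c).continuous_fderiv (by simp)
    refine setIntegral_mono (integrableOn_bounded hb (by fun_prop))
      (integrableOn_bounded hb (by fun_prop)) ?_
    intro x
    show ‖fderiv ℝ (U c) x‖ ^ 2 ≤ ‖c‖ ^ 2 * (∑ j, ‖fderiv ℝ (u j) x‖) ^ 2
    rw [← mul_pow]
    have hd : ∀ j, DifferentiableAt ℝ (u j) x := fun j => (husm j).differentiable (by simp) x
    have e : fderiv ℝ (U c) x = ∑ j, c j • fderiv ℝ (u j) x := by
      rw [hU, fderiv_sum fun j _ => (hd j).const_smul _]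
      refine Finset.sum_congr rfl fun j _ => ?_
      rw [fderiv_const_smul (hd j)]
    gcongr
    rw [e, Finset.mul_sum]
    refine (norm_sum_le _ _).trans (Finset.sum_le_sum fun j _ => ?_)
    rw [norm_smul]
    gcongr
    exact norm_le_pi_norm c j
  have hbdd : BddAbove { r : ℝ | ∃ u ∈ V, (0 < ∫ x in Ω, (u x) ^ 2) ∧ r = rayleigh Ω u } := by
    refine ⟨M / m, ?_⟩
    rintro r ⟨v, hv, hvpos, rfl⟩
    obtain ⟨c, hc⟩ := hrep v hv
    have e1 : ∫ x in Ω, v x ^ 2 = ∫ x in Ω, (U c x) ^ 2 :=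
      setIntegral_congr_fun ho.measurableSet fun x hx => by simp only [hc x hx]
    have e2 : ∫ x in Ω, ‖fderiv ℝ v x‖ ^ 2 = ∫ x in Ω, ‖fderiv ℝ (U c) x‖ ^ 2 := by
      refine setIntegral_congr_fun ho.measurableSet fun x hx => ?_
      have : v =ᶠ[nhds x] U c := by
        filter_upwards [ho.mem_nhds hx] with y hy using hc y hy
      simp only [this.fderiv_eq]
    rw [rayleigh, e1, e2]
    rw [e1] at hvpos
    have hc0 : c ≠ 0 := by
      rintro rfl
      simp at hvpos
    have hcn : 0 < ‖c‖ := norm_pos_iff.2 hc0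
    calc _ ≤ (‖c‖ ^ 2 * M) / (‖c‖ ^ 2 * m) :=
          div_le_div₀ (by positivity) (hDup c) (by positivity) (hNlow c)
      _ = M / m := by field_simp
  -- a constrained element
  have hφsum : ∀ (s : Finset (Fin (k + 1))) (c : Fin (k + 1) → ℝ),
      φ (∑ j ∈ s, c j • u j) = ∑ j ∈ s, c j • φ (u j) := by
    intro s c
    induction s using Finset.induction_on with
    | empty =>
      have := hφsmul 0 0 continuous_zero
      simpa using this
    | insert a s ha ih =>
      have hcont : Continuous (∑ j ∈ s, c j • u j) := by
        have e : (∑ j ∈ s, c j • u j) = fun x => ∑ j ∈ s, c j * u j x := by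
          ext x; simp
        rw [e]; fun_prop
      rw [Finset.sum_insert ha, Finset.sum_insert ha, hφadd _ _ ((huc a).const_smul _) hcont,
        hφsmul _ _ (huc a), ih]
  let Φ : (Fin (k + 1) → ℝ) →ₗ[ℝ] (Fin k → ℝ) := Fintype.linearCombination ℝ fun j => φ (u j)
  have hker : LinearMap.ker Φ ≠ ⊥ := LinearMap.ker_ne_bot_of_finrank_lt (by simp)
  obtain ⟨c, hc, hcne⟩ := (Submodule.ne_bot_iff _).1 hker
  have hφ0 : φ (U c) = 0 := by
    rw [hU, hφsum]
    have : Φ c = 0 := hc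
    rwa [Fintype.linearCombination_apply] at this
  have hfin := H (U c) (hUsm c) hφ0
  refine le_csSup_of_le hbdd ⟨U c, hUV c, hpos c hcne, rfl⟩ ?_
  rw [rayleigh, le_div_iff₀ (hpos c hcne)]
  exact hfin

lemma neumann_upper {d k : ℕ} {Ω : Set (Euc d)} (A : ℝ) (hA : 0 ≤ A)
    (V : Submodule ℝ (Euc d → ℝ)) (hV : ∀ u ∈ V, ContDiff ℝ (⊤ : ℕ∞) u)
    (hVf : Module.finrank ℝ (V.map (LinearMap.funLeft ℝ ℝ ((↑) : Ω → Euc d))) = k + 1)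
    (H : ∀ u ∈ V, ∫ x in Ω, ‖fderiv ℝ u x‖ ^ 2 ≤ A * ∫ x in Ω, u x ^ 2) :
    neumannEigenvalue k Ω ≤ A := by
  refine csInf_le_of_le ⟨0, ?_⟩ ⟨V, hV, hVf, rfl⟩ ?_
  · rintro t ⟨V, -, -, rfl⟩
    apply Real.sSup_nonneg
    rintro r ⟨u, -, -, rfl⟩
    exact div_nonneg (integral_nonneg fun x => sq_nonneg _) (integral_nonneg fun x => sq_nonneg _)
  · refine Real.sSup_le ?_ hA
    rintro r ⟨u, hu, hp, rfl⟩
    rw [rayleigh, div_le_iff₀ hp]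
    exact H u hu

lemma neumann_nonneg {d k : ℕ} (Ω : Set (Euc d)) : 0 ≤ neumannEigenvalue k Ω := by
  apply Real.sInf_nonneg
  rintro t ⟨V, -, -, rfl⟩
  apply Real.sSup_nonneg
  rintro r ⟨u, -, -, rfl⟩
  exact div_nonneg (integral_nonneg fun x => sq_nonneg _) (integral_nonneg fun x => sq_nonneg _)

lemma int_cos_zero (ℓ ω : ℝ) (hω : ω ≠ 0) (h : ω * ℓ = π) (m : ℤ) (hm : m ≠ 0) :
    ∫ y in (0:ℝ)..ℓ, Real.cos (m * ω * y) = 0 := by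
  have hmω : (m:ℝ) * ω ≠ 0 := mul_ne_zero (by exact_mod_cast hm) hω
  rw [intervalIntegral.integral_comp_mul_left (fun y => Real.cos y) hmω, integral_cos, mul_assoc, h,
    Real.sin_int_mul_pi]
  simp

lemma int_cos_cos (ℓ ω : ℝ) (hω : ω ≠ 0) (h : ω * ℓ = π) (i j : ℕ) (hij : i ≠ j) :
    ∫ y in (0:ℝ)..ℓ, Real.cos (i * ω * y) * Real.cos (j * ω * y) = 0 ∧
    ∫ y in (0:ℝ)..ℓ, Real.sin (i * ω * y) * Real.sin (j * ω * y) = 0 := by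
  have h1 := int_cos_zero ℓ ω hω h ((i:ℤ) - j) (by omega)
  have h2 := int_cos_zero ℓ ω hω h ((i:ℤ) + j) (by omega)
  push_cast at h1 h2
  have e1 : ∀ y : ℝ, Real.cos (i * ω * y) * Real.cos (j * ω * y) =
      (1/2) * Real.cos (((i:ℝ) - j) * ω * y) + (1/2) * Real.cos (((i:ℝ) + j) * ω * y) := by
    intro y
    rw [show ((i:ℝ) - j) * ω * y = i * ω * y - j * ω * y by ring,
      show ((i:ℝ) + j) * ω * y = i * ω * y + j * ω * y by ring, Real.cos_sub, Real.cos_add]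
    ring
  have e2 : ∀ y : ℝ, Real.sin (i * ω * y) * Real.sin (j * ω * y) =
      (1/2) * Real.cos (((i:ℝ) - j) * ω * y) - (1/2) * Real.cos (((i:ℝ) + j) * ω * y) := by
    intro y
    rw [show ((i:ℝ) - j) * ω * y = i * ω * y - j * ω * y by ring,
      show ((i:ℝ) + j) * ω * y = i * ω * y + j * ω * y by ring, Real.cos_sub, Real.cos_add]
    ring
  have c1 : Continuous fun y : ℝ => (1/2:ℝ) * Real.cos (((i:ℝ) - j) * ω * y) := by fun_prop
  have c2 : Continuous fun y : ℝ => (1/2:ℝ) * Real.cos (((i:ℝ) + j) * ω * y) := by fun_prop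
  constructor
  · simp_rw [e1]
    rw [intervalIntegral.integral_add (c1.intervalIntegrable _ _) (c2.intervalIntegrable _ _),
      intervalIntegral.integral_const_mul, intervalIntegral.integral_const_mul, h1, h2]
    simp
  · simp_rw [e2]
    rw [intervalIntegral.integral_sub (c1.intervalIntegrable _ _) (c2.intervalIntegrable _ _),
      intervalIntegral.integral_const_mul, intervalIntegral.integral_const_mul, h1, h2]
    simp

lemma int_cos_sq (ℓ ω : ℝ) (hℓ : 0 < ℓ) (hω : ω ≠ 0) (h : ω * ℓ = π) (i : ℕ) :
    0 < ∫ y in (0:ℝ)..ℓ, Real.cos (i * ω * y) * Real.cos (i * ω * y) ∧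
    ∫ y in (0:ℝ)..ℓ, Real.sin (i * ω * y) * Real.sin (i * ω * y) ≤
      ∫ y in (0:ℝ)..ℓ, Real.cos (i * ω * y) * Real.cos (i * ω * y) := by
  have c1 : Continuous fun y : ℝ => Real.cos (i * ω * y) * Real.cos (i * ω * y) := by fun_prop
  have c2 : Continuous fun y : ℝ => Real.sin (i * ω * y) * Real.sin (i * ω * y) := by fun_prop
  have hs := intervalIntegral.integral_add (c1.intervalIntegrable (μ := volume) 0 ℓ)
    (c2.intervalIntegrable 0 ℓ)
  have hd := intervalIntegral.integral_sub (c1.intervalIntegrable (μ := volume) 0 ℓ)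
    (c2.intervalIntegrable 0 ℓ)
  have e1 : ∀ y : ℝ, Real.cos (i * ω * y) * Real.cos (i * ω * y) +
      Real.sin (i * ω * y) * Real.sin (i * ω * y) = 1 := by
    intro y; have := Real.sin_sq_add_cos_sq (i * ω * y); nlinarith
  have e2 : ∀ y : ℝ, Real.cos (i * ω * y) * Real.cos (i * ω * y) -
      Real.sin (i * ω * y) * Real.sin (i * ω * y) = Real.cos ((2 * i : ℤ) * ω * y) := by
    intro y
    rw [← Real.cos_add]; congr 1; push_cast; ring
  simp only [e1] at hs
  simp only [e2] at hd
  have hdn : 0 ≤ ∫ y in (0:ℝ)..ℓ, Real.cos ((2 * i : ℤ) * ω * y) := by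
    by_cases hi : i = 0
    · subst hi; simp [hℓ.le]
    · rw [int_cos_zero ℓ ω hω h (2 * i : ℤ) (by omega)]
  rw [hd] at hdn
  simp at hs
  constructor <;> linarith

lemma trig_sum {k : ℕ} (c : Fin k → ℝ) (ℓ : ℝ) (f : Fin k → ℝ → ℝ) (hf : ∀ i, Continuous (f i))
    (ho : ∀ i j, i ≠ j → ∫ y in (0:ℝ)..ℓ, f i y * f j y = 0) :
    ∫ y in (0:ℝ)..ℓ, (∑ i, c i * f i y) ^ 2 = ∑ i, c i ^ 2 * ∫ y in (0:ℝ)..ℓ, f i y * f i y := by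
  have e : ∀ y, (∑ i, c i * f i y) ^ 2 = ∑ i, ∑ j, c i * c j * (f i y * f j y) := by
    intro y
    rw [sq, Finset.sum_mul_sum]
    refine Finset.sum_congr rfl fun i _ => Finset.sum_congr rfl fun j _ => by ring
  simp_rw [e]
  rw [intervalIntegral.integral_finsetSum fun i _ => Continuous.intervalIntegrable (by fun_prop) _ _]
  refine Finset.sum_congr rfl fun i _ => ?_
  rw [intervalIntegral.integral_finsetSum fun i _ => Continuous.intervalIntegrable (by fun_prop) _ _]
  simp_rw [intervalIntegral.integral_const_mul]
  rw [Finset.sum_eq_single i]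
  · ring
  · intro j _ hj
    rw [ho i j hj.symm, mul_zero]
  · simp

/-- One-dimensional trigonometric sums. -/
lemma trig_bounds (k : ℕ) (c : Fin (k+1) → ℝ) (ℓ ω : ℝ) (hℓ : 0 < ℓ) (hω : ω ≠ 0) (h : ω * ℓ = π) :
    (c ≠ 0 → 0 < ∫ y in (0:ℝ)..ℓ, (∑ i, c i * Real.cos (i * ω * y)) ^ 2) ∧
    ∫ y in (0:ℝ)..ℓ, (∑ i, (c i * (i * ω)) * Real.sin (i * ω * y)) ^ 2 ≤
      (k * ω) ^ 2 * ∫ y in (0:ℝ)..ℓ, (∑ i, c i * Real.cos (i * ω * y)) ^ 2 := by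
  rw [trig_sum c ℓ (fun i y => Real.cos (i * ω * y)) (fun i => by fun_prop)
      (fun i j hij => (int_cos_cos ℓ ω hω h i j (by simpa [Fin.ext_iff] using hij)).1),
    trig_sum (fun i => c i * (i * ω)) ℓ (fun i y => Real.sin (i * ω * y)) (fun i => by fun_prop)
      (fun i j hij => (int_cos_cos ℓ ω hω h i j (by simpa [Fin.ext_iff] using hij)).2)]
  constructor
  · intro hc
    obtain ⟨i, hi⟩ := Function.ne_iff.1 hc
    refine Finset.sum_pos' (fun j _ => mul_nonneg (sq_nonneg _) (int_cos_sq ℓ ω hℓ hω h j).1.le)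
      ⟨i, Finset.mem_univ _, ?_⟩
    have : c i ≠ 0 := hi
    have := (int_cos_sq ℓ ω hℓ hω h i).1
    positivity
  · rw [Finset.mul_sum]
    refine Finset.sum_le_sum fun i _ => ?_
    obtain ⟨h1, h2⟩ := int_cos_sq ℓ ω hℓ hω h i
    have hik : (i:ℝ) ≤ k := by exact_mod_cast Nat.lt_succ_iff.1 i.2
    have h3 : ((i:ℝ) * ω) ^ 2 ≤ (k * ω) ^ 2 := by
      rw [mul_pow, mul_pow]; gcongr
    calc _ ≤ (c i * (i * ω)) ^ 2 * ∫ y in (0:ℝ)..ℓ, Real.cos (i * ω * y) * Real.cos (i * ω * y) := by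
          gcongr
      _ = (i * ω) ^ 2 * (c i ^ 2 * ∫ y in (0:ℝ)..ℓ, Real.cos (i * ω * y) * Real.cos (i * ω * y)) := by
          ring
      _ ≤ _ := by
          apply mul_le_mul_of_nonneg_right h3; positivity

/-- Cosine test functions depending on the first coordinate. -/
def cosT (n k : ℕ) (a ω : ℝ) : (Fin (k+1) → ℝ) →ₗ[ℝ] (Euc (n+1) → ℝ) :=
  Fintype.linearCombination ℝ (fun (i : Fin (k+1)) (p : Euc (n+1)) => Real.cos (i * ω * (p 0 - a)))

lemma cosT_apply (n k : ℕ) (a ω : ℝ) (c : Fin (k+1) → ℝ) (p : Euc (n+1)) :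
    cosT n k a ω c p = ∑ i, c i * Real.cos (i * ω * (p 0 - a)) := by
  rw [cosT, Fintype.linearCombination_apply]
  simp

lemma cosT_smooth (n k : ℕ) (a ω : ℝ) (c : Fin (k+1) → ℝ) :
    ContDiff ℝ (⊤ : ℕ∞) (cosT n k a ω c) := by
  have : cosT n k a ω c = fun p => ∑ i, c i * Real.cos (i * ω * (p 0 - a)) := by
    ext p; exact cosT_apply ..
  rw [this]
  fun_prop

lemma cosT_fderiv (n k : ℕ) (a ω : ℝ) (c : Fin (k+1) → ℝ) (p : Euc (n+1)) :
    ‖fderiv ℝ (cosT n k a ω c) p‖ ^ 2 ≤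
      (∑ i, (c i * (i * ω)) * Real.sin (i * ω * (p 0 - a))) ^ 2 := by
  set g : ℝ → ℝ := fun x => ∑ i, c i * Real.cos (i * ω * (x - a)) with hg
  have e : cosT n k a ω c = g ∘ (EuclideanSpace.proj (𝕜 := ℝ) (0 : Fin (n+1))) := by
    ext p; exact cosT_apply ..
  have hgd : HasDerivAt g (∑ i, c i * (-Real.sin (i * ω * (p 0 - a)) * (i * ω))) (p 0) := by
    refine HasDerivAt.fun_sum fun i _ => HasDerivAt.const_mul _ ?_
    refine HasDerivAt.cos ?_
    simpa using ((hasDerivAt_id (p 0)).sub_const a).const_mul ((i:ℝ) * ω)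
  have hf : HasFDerivAt (cosT n k a ω c)
      ((∑ i, c i * (-Real.sin (i * ω * (p 0 - a)) * (i * ω))) •
        (EuclideanSpace.proj (𝕜 := ℝ) (0 : Fin (n+1)))) p := by
    rw [e]
    exact HasDerivAt.comp_hasFDerivAt p hgd (ContinuousLinearMap.hasFDerivAt _)
  rw [hf.fderiv, norm_smul]
  have hn : ‖(EuclideanSpace.proj (𝕜 := ℝ) (0 : Fin (n+1)) : Euc (n+1) →L[ℝ] ℝ)‖ ≤ 1 := by
    refine ContinuousLinearMap.opNorm_le_bound _ zero_le_one fun x => ?_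
    rw [one_mul]
    exact PiLp.norm_apply_le x 0
  have e2 : (∑ i, c i * (-Real.sin (i * ω * (p 0 - a)) * (i * ω))) =
      -∑ i, (c i * (i * ω)) * Real.sin (i * ω * (p 0 - a)) := by
    rw [← Finset.sum_neg_distrib]
    refine Finset.sum_congr rfl fun i _ => by ring
  rw [e2, norm_neg, mul_pow, Real.norm_eq_abs, sq_abs]
  refine mul_le_of_le_one_right (sq_nonneg _) ?_
  exact pow_le_one₀ (norm_nonneg _) hn

lemma int_first (n : ℕ) (a ℓ r : ℝ) (hℓ : 0 < ℓ) (hr : 0 < r) (f : ℝ → ℝ) (hf : Continuous f) :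
    ∫ p in Dom (n := n) a (a+ℓ) (fun _ => r), f (p 0 - a) = r ^ n * ∫ y in (0:ℝ)..ℓ, f y := by
  rw [fubini a (a+ℓ) (fun _ => r) (by linarith) (fun _ _ _ => hr) continuous_const
    (fun p => f (p 0 - a)) (by fun_prop)]
  simp only [JL_zero, integral_const, probReal_univ, one_smul]
  rw [intervalIntegral.integral_const_mul,
    intervalIntegral.integral_comp_sub_right (fun y => f y) a]
  simp

lemma cosT_bounds (n k : ℕ) (a ℓ r ω : ℝ) (hℓ : 0 < ℓ) (hr : 0 < r) (hω : ω ≠ 0) (h : ω * ℓ = π)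
    (c : Fin (k+1) → ℝ) :
    (c ≠ 0 → 0 < ∫ p in Dom (n := n) a (a+ℓ) (fun _ => r), cosT n k a ω c p ^ 2) ∧
    ∫ p in Dom (n := n) a (a+ℓ) (fun _ => r), ‖fderiv ℝ (cosT n k a ω c) p‖ ^ 2 ≤
      (k * ω) ^ 2 * ∫ p in Dom (n := n) a (a+ℓ) (fun _ => r), cosT n k a ω c p ^ 2 := by
  obtain ⟨h1, h2⟩ := trig_bounds k c ℓ ω hℓ hω h
  have e1 := int_first n a ℓ r hℓ hr (fun y => (∑ i, c i * Real.cos (i * ω * y)) ^ 2) (by fun_prop)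
  have e2 := int_first n a ℓ r hℓ hr (fun y => (∑ i, (c i * (i * ω)) * Real.sin (i * ω * y)) ^ 2)
    (by fun_prop)
  simp only [cosT_apply]
  rw [e1]
  refine ⟨fun hc => mul_pos (by positivity) (h1 hc), ?_⟩
  have hb : Bornology.IsBounded (Dom (n := n) a (a+ℓ) (fun _ => r)) :=
    Dom_bounded _ _ _ continuous_const
  have hcc : Continuous (fderiv ℝ (cosT n k a ω c)) :=
    (cosT_smooth n k a ω c).continuous_fderiv (by simp)
  calc _ ≤ ∫ p in Dom (n := n) a (a+ℓ) (fun _ => r),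
        (∑ i, (c i * (i * ω)) * Real.sin (i * ω * (p 0 - a))) ^ 2 :=
        setIntegral_mono (integrableOn_bounded hb (by fun_prop))
          (integrableOn_bounded hb (by fun_prop)) fun p => cosT_fderiv n k a ω c p
    _ ≤ _ := by
        rw [e2]
        calc _ ≤ r ^ n * ((k * ω) ^ 2 * ∫ y in (0:ℝ)..ℓ, (∑ i, c i * Real.cos (i * ω * y)) ^ 2) := by
              gcongr
          _ = _ := by ring

lemma cosT_finrank (n k : ℕ) (a ℓ r ω : ℝ) (hℓ : 0 < ℓ) (hr : 0 < r) (hω : ω ≠ 0) (h : ω * ℓ = π)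
    (Ω : Set (Euc (n+1))) (hΩ : Dom (n := n) a (a+ℓ) (fun _ => r) ⊆ Ω) :
    Module.finrank ℝ ((LinearMap.range (cosT n k a ω)).map
      (LinearMap.funLeft ℝ ℝ ((↑) : Ω → Euc (n+1)))) = k + 1 := by
  rw [← LinearMap.range_comp, LinearMap.finrank_range_of_inj]
  · simp
  · rw [injective_iff_map_eq_zero]
    intro c hc
    by_contra hne
    have := (cosT_bounds n k a ℓ r ω hℓ hr hω h c).1 hne
    have hz : ∫ p in Dom (n := n) a (a+ℓ) (fun _ => r), cosT n k a ω c p ^ 2 = 0 := by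
      refine setIntegral_eq_zero_of_forall_eq_zero fun p hp => ?_
      have := congrFun hc ⟨p, hΩ hp⟩
      have h3 : cosT n k a ω c p = 0 := this
      rw [h3]; simp
    linarith

lemma upper_box (n k : ℕ) (a ℓ r : ℝ) (hℓ : 0 < ℓ) (hr : 0 < r) :
    neumannEigenvalue k (Dom (n := n) a (a+ℓ) (fun _ => r)) ≤ (k * (π / ℓ)) ^ 2 := by
  have hω : π / ℓ ≠ 0 := (div_pos pi_pos hℓ).ne'
  have h : π / ℓ * ℓ = π := by field_simp
  refine neumann_upper _ (sq_nonneg _) (LinearMap.range (cosT n k a (π/ℓ))) ?_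
    (cosT_finrank n k a ℓ r _ hℓ hr hω h _ subset_rfl) ?_
  · rintro u ⟨c, rfl⟩; exact cosT_smooth ..
  · rintro u ⟨c, rfl⟩; exact (cosT_bounds n k a ℓ r _ hℓ hr hω h c).2

lemma lower_dom {n m : ℕ} (ε ρ s L : ℝ) (hs : 1 ≤ s) (hn : (n:ℝ) + 1 = 4 * s)
    (hn1 : 1 ≤ n) (hε : 0 < ε) (hρ0 : 0 < ρ) (hρ1 : ρ < 1) (h1 : ρ * (1 + ε ^ 2 * n) ≤ 1)
    (h2 : ρ ^ 2 * (2 * s + 83 / 50) ^ 2 * (2 ^ n * (ε ^ 2 * n)) ≤ 1 - ρ)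
    (hL : L = 2 * ρ + m * (ρ * π / (2 * s + 83 / 50))) (hL0 : 0 < L)
    (hpos : ∀ x, 0 < x → x < L → 0 < prof ε ρ L x)
    (hne : ∃ V : Submodule ℝ (Euc (n+1) → ℝ), (∀ u ∈ V, ContDiff ℝ (⊤ : ℕ∞) u) ∧
      Module.finrank ℝ (V.map (LinearMap.funLeft ℝ ℝ
        ((↑) : Dom (n := n) 0 L (prof ε ρ L) → Euc (n+1)))) = (m + 1) + 1) :
    ρ ^ 2 * (2 * s + 83 / 50) ^ 2 ≤
      neumannEigenvalue (m + 1) (Dom (n := n) 0 L (prof ε ρ L)) := by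
  have hintg : ∀ (u : Euc (n+1) → ℝ) (x : ℝ), Continuous u →
      Integrable (fun z => u (JL n (x, prof ε ρ L x • z))) (muQ n) := by
    intro u x hu
    exact integrable_muQ (by fun_prop)
  refine neumann_lower (Dom_open _ _ _ (prof_cont ε ρ L)) (Dom_bounded _ _ _ (prof_cont ε ρ L)) _
    hne (fun u i => avg u (prof ε ρ L) (ρ + (i:ℕ) * (ρ * π / (2 * s + 83 / 50)))) ?_ ?_ ?_
  · intro u v hu hv
    funext i
    simp only [avg, Pi.add_apply]
    exact integral_add (hintg u _ hu) (hintg v _ hv)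
  · intro c u hu
    funext i
    simp only [avg, Pi.smul_apply, smul_eq_mul]
    exact integral_const_mul _ _
  · intro u hu hz
    have hlow := lower (n := n) u (hu.of_le (by exact_mod_cast le_top)) m ε ρ s L hs hn hn1 hε hρ0 hρ1 h1 h2 hL (by
      intro i hi
      exact congrFun hz ⟨i, by omega⟩)
    have hcc : Continuous (fderiv ℝ u) := hu.continuous_fderiv (by simp)
    have huc := hu.continuous
    rw [fubini 0 L _ hL0.le hpos (prof_cont ε ρ L) (fun p => u p ^ 2) (by fun_prop),
      fubini 0 L _ hL0.le hpos (prof_cont ε ρ L) (fun p => ‖fderiv ℝ u p‖ ^ 2) (by fun_prop)]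
    exact hlow

lemma main_aux (n m : ℕ) (hn3 : 3 ≤ n) :
    alphaConst (m+1) (n+1) ≤ π ^ 2 * ((m:ℝ)+1) ^ 2 / ((n:ℝ) - 2 + ((m:ℝ) + 2) * π) ^ 2 := by
  have hn3' : (3:ℝ) ≤ n := by exact_mod_cast hn3
  have hm0 : (0:ℝ) ≤ m := by positivity
  have hpi := pi_pos
  obtain ⟨s, hs⟩ : ∃ s : ℝ, s = ((n:ℝ)+1)/4 := ⟨_, rfl⟩
  obtain ⟨S, hS⟩ : ∃ S : ℝ, S = 2 * s + 83/50 := ⟨_, rfl⟩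
  obtain ⟨T, hT⟩ : ∃ T : ℝ, T = (n:ℝ) - 2 + ((m:ℝ) + 2) * π := ⟨_, rfl⟩
  obtain ⟨R, hR⟩ : ∃ R : ℝ, R = 2 * S + m * π := ⟨_, rfl⟩
  have hs1 : 1 ≤ s := by linarith
  have hS0 : 0 < S := by linarith
  have hT0 : 0 < T := by rw [hT]; have : 0 < ((m:ℝ)+2) * π := by positivity
                         linarith
  have hTR : T < R := by
    have := pi_lt_d2
    rw [hT, hR, hS, hs]; linarith
  have hR0 : 0 < R := hT0.trans hTR
  obtain ⟨τ, hτ⟩ : ∃ τ : ℝ, τ = T / R := ⟨_, rfl⟩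
  have hτ0 : 0 < τ := by rw [hτ]; positivity
  have hτ1 : τ < 1 := by rw [hτ, div_lt_one hR0]; exact hTR
  obtain ⟨ρ, hρ⟩ : ∃ ρ : ℝ, ρ = 1 - (1 - τ) / 3 := ⟨_, rfl⟩
  have hρ0 : 0 < ρ := by linarith
  have hρ1 : ρ < 1 := by linarith
  have hρ3 : τ ≤ ρ ^ 3 := by
    have : τ = 1 - 3 * (1 - ρ) := by linarith
    rw [this]; nlinarith [mul_nonneg (sq_nonneg (1 - ρ)) (by linarith : 0 ≤ 2 + ρ)]
  obtain ⟨K, hK⟩ : ∃ K : ℝ, K = ρ^2 * S^2 * 2^n * n + ρ * n + 1 := ⟨_, rfl⟩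
  have hKa : 0 ≤ ρ^2 * S^2 * 2^n * n := by positivity
  have hKb : 0 ≤ ρ * n := by positivity
  have hK0 : 0 < K := by linarith
  obtain ⟨ε, hε⟩ : ∃ ε : ℝ, ε = Real.sqrt ((1 - ρ) / K) := ⟨_, rfl⟩
  have hq : 0 < (1 - ρ) / K := div_pos (by linarith) hK0
  have hε0 : 0 < ε := by rw [hε]; exact Real.sqrt_pos.2 hq
  have hε2 : ε ^ 2 * K = 1 - ρ := by
    rw [hε, Real.sq_sqrt hq.le]; field_simp
  have hc1 : ρ * (1 + ε ^ 2 * n) ≤ 1 := by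
    have : ε ^ 2 * (ρ * n) ≤ ε ^ 2 * K := by gcongr; linarith
    nlinarith
  have hc2 : ρ ^ 2 * (2 * s + 83 / 50) ^ 2 * (2 ^ n * (ε ^ 2 * n)) ≤ 1 - ρ := by
    rw [← hS]
    have : ε ^ 2 * (ρ^2 * S^2 * 2^n * n) ≤ ε ^ 2 * K := by gcongr; linarith
    nlinarith
  obtain ⟨L, hL⟩ : ∃ L : ℝ, L = 2 * ρ + m * (ρ * π / S) := ⟨_, rfl⟩
  have hSL : S * L = ρ * R := by rw [hL, hR]; field_simp
  have hL0 : 0 < L := by rw [hL]; positivity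
  obtain ⟨η, hη⟩ : ∃ η : ℝ, η = (1 - ρ) * L / 2 := ⟨_, rfl⟩
  have hη0 : 0 < η := by rw [hη]; have : 0 < 1 - ρ := by linarith
                         positivity
  obtain ⟨ℓ, hℓ⟩ : ∃ ℓ : ℝ, ℓ = ρ * L := ⟨_, rfl⟩
  have hℓ0 : 0 < ℓ := by rw [hℓ]; positivity
  have hηℓ : η + ℓ = L - η := by rw [hη, hℓ]; ring
  obtain ⟨r, hr⟩ : ∃ r : ℝ, r = ε * min η ρ := ⟨_, rfl⟩
  have hr0 : 0 < r := by rw [hr]; have : 0 < min η ρ := lt_min hη0 hρ0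
                         positivity
  have hpos : ∀ x, 0 < x → x < L → 0 < prof ε ρ L x := by
    intro x h0 h1
    exact mul_pos hε0 (lt_min h0 (lt_min hρ0 (by linarith)))
  have hsub : Dom (n := n) η (η + ℓ) (fun _ => r) ⊆ Dom (n := n) 0 L (prof ε ρ L) := by
    rintro p ⟨⟨h1, h2⟩, h3⟩
    refine ⟨⟨by linarith, by linarith⟩, fun i => ⟨(h3 i).1, (h3 i).2.trans_le ?_⟩⟩
    show r ≤ ε * min (p 0) (min ρ (L - p 0))
    rw [hr]
    refine mul_le_mul_of_nonneg_left ?_ hε0.le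
    refine le_min ((min_le_left _ _).trans h1.le) (le_min (min_le_right _ _) ?_)
    exact (min_le_left _ _).trans (by linarith)
  have hup := upper_box n (m+1) η ℓ r hℓ0 hr0
  have hlo : ρ ^ 2 * S ^ 2 ≤ neumannEigenvalue (m + 1) (Dom (n := n) 0 L (prof ε ρ L)) := by
    rw [hS]
    refine lower_dom ε ρ s L hs1 (by rw [hs]; ring) (by omega) hε0 hρ0 hρ1 hc1 hc2 (by rw [hL, hS])
      hL0 hpos ⟨LinearMap.range (cosT n (m+1) η (π/ℓ)), ?_, ?_⟩
    · rintro u ⟨c, rfl⟩; exact cosT_smooth ..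
    · exact cosT_finrank n (m+1) η ℓ r _ hℓ0 hr0 (div_pos pi_pos hℓ0).ne' (by field_simp) _ hsub
  have hlo0 : 0 < ρ ^ 2 * S ^ 2 := by positivity
  have hbd : BddBelow { r : ℝ | ∃ Ω₁ Ω₂ : Set (Euc (n+1)), IsConvexDomain Ω₁ ∧ IsConvexDomain Ω₂ ∧
      Ω₁ ⊆ Ω₂ ∧ r = neumannEigenvalue (m+1) Ω₁ / neumannEigenvalue (m+1) Ω₂ } := by
    refine ⟨0, ?_⟩
    rintro _ ⟨Ω₁, Ω₂, -, -, -, rfl⟩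
    exact div_nonneg (neumann_nonneg _) (neumann_nonneg _)
  refine csInf_le_of_le hbd ⟨_, _,
    Dom_isConvexDomain η (η+ℓ) (fun _ => r) (by linarith) (fun _ _ _ => hr0) continuous_const
      (concaveOn_const _ convex_univ),
    Dom_isConvexDomain 0 L (prof ε ρ L) hL0 hpos (prof_cont _ _ _) (prof_concave _ _ _ hε0.le),
    hsub, rfl⟩ ?_
  rw [← hT]
  have key : T ≤ ρ * S * ℓ := by
    have e : ρ * S * ℓ = ρ ^ 3 * R := by
      rw [hℓ]; calc ρ * S * (ρ * L) = ρ ^ 2 * (S * L) := by ring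
        _ = _ := by rw [hSL]; ring
    rw [e]
    calc T = τ * R := by rw [hτ]; field_simp
      _ ≤ _ := by gcongr
  calc _ ≤ (((m+1 : ℕ):ℝ) * (π / ℓ)) ^ 2 / (ρ ^ 2 * S ^ 2) :=
        div_le_div₀ (sq_nonneg _) hup hlo0 hlo
    _ = π ^ 2 * ((m:ℝ)+1) ^ 2 / (ρ * S * ℓ) ^ 2 := by
        push_cast; field_simp
    _ ≤ _ := by gcongr

/-- for `k ≥ 1` and `d ≥ 4`, `α_{k,d} ≤ π²k²/(d - 3 + (k+1)π)²`. -/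
theorem alpha_upper_bound_high_dim
    (k d : ℕ) (hk : 1 ≤ k) (hd : 4 ≤ d) :
    alphaConst k d ≤
      Real.pi ^ 2 * (k : ℝ) ^ 2 / ((d : ℝ) - 3 + ((k : ℝ) + 1) * Real.pi) ^ 2 := by
  obtain ⟨m, rfl⟩ : ∃ m, k = m + 1 := ⟨k - 1, by omega⟩
  obtain ⟨n, rfl⟩ : ∃ n, d = n + 1 := ⟨d - 1, by omega⟩
  have h := main_aux n m (by omega)
  push_cast
  rw [show (n:ℝ) + 1 - 3 + ((m:ℝ) + 1 + 1) * π = (n:ℝ) - 2 + ((m:ℝ) + 2) * π by ring]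
  exact h

end
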